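/- arXiv:1301.3746 — 2 statements merged into one kernel-verified Lean document; each statement's English description precedes it below -/
import Mathlib

section
/- There exists a subgroup K of π₁(𝓗, 0) such that: K is open (h⁻¹(K) is open in Ω(𝓗,0)); the only normal subgroup of π₁(𝓗,0) contained in K is trivial; and there is no covering map p : E → 𝓗 with E connected and locally path-connected together with a point e ∈ E satisfying p(e) = 0 for which the image of the induced homomorphism p_# : π₁(E,e) → π₁(𝓗,0) equals K. -/
/-- The homotopy class of a loop, as an element of the fundamental group. -/
noncomputable def pathClass {X : Type*} [TopologicalSpace X] {x : X} (γ : Path x x) :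
    FundamentalGroup X x :=
  FundamentalGroup.fromPath (X := TopCat.of X) (Quotient.mk (Path.Homotopic.setoid x x) γ)

/-- The image `p_#(π₁(E,e))` of the homomorphism induced on fundamental groups by a
continuous map `p : E → X` with `p e = x`, as a subset of `π₁(X,x)`. -/
noncomputable def inducedImage {E X : Type*} [TopologicalSpace E] [TopologicalSpace X]
    {p : E → X} (hp : Continuous p) (e : E) {x : X} (hx : p e = x) :
    Set (FundamentalGroup X x) :=
  {g | ∃ γ : Path e e, g = pathClass ((γ.map hp).cast hx.symm hx.symm)}

/-- The `i`-th circle of the Hawaiian Earring: the circle of radius `1/i`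
centered at `(0, 1/i)`. -/
def hawaiianCircle (i : ℕ) : Set (ℝ × ℝ) :=
  {p | p.1 ^ 2 + (p.2 - 1 / (i : ℝ)) ^ 2 = (1 / (i : ℝ)) ^ 2}

/-- The Hawaiian Earring `𝓗 = ⋃_{i ≥ 1} C_i ⊆ ℝ²`, with the subspace topology. -/
def HawaiianEarring : Set (ℝ × ℝ) :=
  ⋃ i ∈ {i : ℕ | 1 ≤ i}, hawaiianCircle i

/-- The basepoint `0 = (0,0)` of the Hawaiian Earring. -/
def hawaiianBasepoint : HawaiianEarring :=
  ⟨(0, 0), Set.mem_iUnion₂.mpr ⟨1, by simp, by simp [hawaiianCircle]⟩⟩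

/-- A realization of a subgroup `K ≤ π₁(𝓗,0)` by a covering of the Hawaiian Earring:
a connected and locally path-connected space `E`, a covering map `p : E → 𝓗`
(a continuous surjection each point of `𝓗` having an evenly covered open neighborhood),
and a point `e ∈ E` with `p e = 0` such that `p_#(π₁(E,e)) = K`. -/
structure CoveringRealization
    (K : Subgroup (FundamentalGroup HawaiianEarring hawaiianBasepoint)) where
  E : Type
  [tE : TopologicalSpace E]
  connE : ConnectedSpace E
  lpcE : LocPathConnectedSpace E
  p : E → HawaiianEarring
  e : E
  cont : Continuous p
  cov : IsCoveringMap p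
  surj : Function.Surjective p
  base : p e = hawaiianBasepoint
  img : inducedImage cont e base = ↑K

namespace HE

open Set Filter Topology unitInterval

/-- On a preconnected space, a locally constant predicate is constant. -/
theorem pred_const {Y : Type*} [TopologicalSpace Y] [PreconnectedSpace Y] {P : Y → Prop}
    (h : ∀ s, ∀ᶠ t in 𝓝 s, (P t ↔ P s)) {a : Y} (ha : P a) (b : Y) : P b := by
  have hcl : IsClopen {x | P x} := by
    constructor
    · rw [← isOpen_compl_iff, isOpen_iff_mem_nhds]
      intro s hs
      filter_upwards [h s] with t ht
      simpa [ht] using hs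
    · rw [isOpen_iff_mem_nhds]
      intro s hs
      filter_upwards [h s] with t ht
      simpa [ht] using hs
  have := hcl.eq_univ ⟨a, ha⟩
  have hb : b ∈ {x | P x} := by rw [this]; trivial
  exact hb

section Cocycle

variable {X : Type*} [TopologicalSpace X] {G : Type*} [Group G]

/-- A local cocycle: `R` is an open neighbourhood of the diagonal and `τ` is a
group-valued cocycle on `R`-close triples. -/
structure IsCocycle (R : X → X → Prop) (τ : X → X → G) : Prop where
  isOpen : IsOpen {p : X × X | R p.1 p.2}
  refl : ∀ x, R x x
  symm : ∀ x y, R x y → R y x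
  coc : ∀ x y z, R x y → R y z → R x z → τ y z * τ x y = τ x z

theorem IsCocycle.self {R : X → X → Prop} {τ : X → X → G} (h : IsCocycle R τ) (x : X) :
    τ x x = 1 := by
  have := h.coc x x x (h.refl x) (h.refl x) (h.refl x)
  simpa using this

/-- A (left) lift of a path along a cocycle. -/
def IsLift (τ : X → X → G) (α : C(I, X)) (g : I → G) : Prop :=
  ∀ s, ∀ᶠ t in 𝓝 s, g t = τ (α s) (α t) * g s

theorem IsLift.mul_right {τ : X → X → G} {α : C(I, X)} {g : I → G} (h : IsLift τ α g) (c : G) :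
    IsLift τ α (fun s => g s * c) := by
  intro s
  filter_upwards [h s] with t ht
  rw [ht, mul_assoc]

theorem IsLift.unique {τ : X → X → G} {α : C(I, X)} {g g' : I → G} (h : IsLift τ α g)
    (h' : IsLift τ α g') (h0 : g 0 = g' 0) (s : I) : g s = g' s := by
  refine pred_const (P := fun s => g s = g' s) ?_ h0 s
  intro s
  filter_upwards [h s, h' s] with t ht ht'
  rw [ht, ht', mul_right_inj]

theorem IsCocycle.eventually_close {R : X → X → Prop} {τ : X → X → G} (h : IsCocycle R τ)
    (α : C(I, X)) : ∀ᶠ β : C(I, X) in 𝓝 α, ∀ s, R (α s) (β s) := by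
  have hc : Continuous (fun β : C(I, X) => (α.prodMk β : C(I, X × X))) := by
    apply ContinuousMap.continuous_of_continuous_uncurry
    change Continuous fun p : C(I, X) × I => (α p.2, p.1 p.2)
    fun_prop
  have h1 : ∀ᶠ f : C(I, X × X) in 𝓝 (α.prodMk α), MapsTo f univ {p : X × X | R p.1 p.2} :=
    ContinuousMap.eventually_mapsTo isCompact_univ h.isOpen (fun s _ => h.refl _)
  have h2 := hc.continuousAt.eventually h1
  filter_upwards [h2] with β hβ s
  exact hβ (mem_univ s)

theorem IsCocycle.eventually_R {R : X → X → Prop} {τ : X → X → G} (h : IsCocycle R τ)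
    {Y : Type*} [TopologicalSpace Y] {a b : Y → X} (ha : Continuous a) (hb : Continuous b) {s : Y}
    (hs : R (a s) (b s)) : ∀ᶠ t in 𝓝 s, R (a t) (b t) := by
  have : Continuous fun t => (a t, b t) := by fun_prop
  exact (h.isOpen.preimage this).mem_nhds hs

theorem IsCocycle.lift_perturb {R : X → X → Prop} {τ : X → X → G} (h : IsCocycle R τ)
    {α β : C(I, X)} {g : I → G} (hg : IsLift τ α g) (hR : ∀ s, R (α s) (β s)) :
    IsLift τ β (fun s => τ (α s) (β s) * g s) := by
  intro s
  have hα := α.continuous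
  have hβ := β.continuous
  filter_upwards [hg s, h.eventually_R (s := s) (continuous_const (y := α s)) hα (h.refl _),
    h.eventually_R (s := s) (continuous_const (y := β s)) hβ (h.refl _),
    h.eventually_R (s := s) (continuous_const (y := α s)) hβ (hR s)] with t h1 h2 h3 h4
  rw [h1, ← mul_assoc, h.coc _ _ _ h2 (hR t) h4, ← mul_assoc, h.coc _ _ _ (hR s) h3 h4]

theorem IsCocycle.exists_lift {R : X → X → Prop} {τ : X → X → G} (h : IsCocycle R τ)
    (α : C(I, X)) : ∃ g : I → G, IsLift τ α g ∧ g 0 = 1 := by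
  suffices H : ∃ g : I → G, IsLift τ α g by
    obtain ⟨g, hg⟩ := H
    exact ⟨fun s => g s * (g 0)⁻¹, hg.mul_right _, by simp⟩
  let A : I → C(I, X) := fun u => ⟨fun s => α (u * s), by fun_prop⟩
  have hA : Continuous A := by
    apply ContinuousMap.continuous_of_continuous_uncurry
    change Continuous fun p : I × I => α (p.1 * p.2)
    fun_prop
  have key : ∃ g : I → G, IsLift τ (A 1) g := by
    refine pred_const (P := fun u => ∃ g : I → G, IsLift τ (A u) g) ?_ (a := 0) ?_ 1
    · intro u
      filter_upwards [hA.continuousAt.eventually (h.eventually_close (A u))] with v hv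
      constructor
      · rintro ⟨g, hg⟩
        exact ⟨_, h.lift_perturb hg (fun s => h.symm _ _ (hv s))⟩
      · rintro ⟨g, hg⟩
        exact ⟨_, h.lift_perturb hg hv⟩
    · refine ⟨fun _ => 1, fun s => Eventually.of_forall fun t => ?_⟩
      simp [A, h.self]
  have : A 1 = α := by ext s; simp [A]
  rwa [this] at key

open Classical in
/-- The lift of `α` starting at `1` (junk if there is none). -/
noncomputable def lft (τ : X → X → G) (α : C(I, X)) : I → G :=
  if h : ∃ g : I → G, IsLift τ α g ∧ g 0 = 1 then h.choose else fun _ => 1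

theorem IsCocycle.lft_isLift {R : X → X → Prop} {τ : X → X → G} (h : IsCocycle R τ)
    (α : C(I, X)) : IsLift τ α (lft τ α) := by
  rw [lft, dif_pos (h.exists_lift α)]
  exact (h.exists_lift α).choose_spec.1

theorem IsCocycle.lft_zero {R : X → X → Prop} {τ : X → X → G} (h : IsCocycle R τ)
    (α : C(I, X)) : lft τ α 0 = 1 := by
  rw [lft, dif_pos (h.exists_lift α)]
  exact (h.exists_lift α).choose_spec.2

theorem IsCocycle.eq_lft {R : X → X → Prop} {τ : X → X → G} (h : IsCocycle R τ)
    {α : C(I, X)} {g : I → G} (hg : IsLift τ α g) (s : I) : g s = lft τ α s * g 0 := by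
  refine hg.unique ((h.lft_isLift α).mul_right _) ?_ s
  simp [h.lft_zero]

theorem IsCocycle.lft_close {R : X → X → Prop} {τ : X → X → G} (h : IsCocycle R τ)
    {α β : C(I, X)} (hR : ∀ s, R (α s) (β s)) (h0 : α 0 = β 0) (s : I) :
    lft τ β s = τ (α s) (β s) * lft τ α s := by
  have := h.eq_lft (h.lift_perturb (h.lft_isLift α) hR) s
  simp only [h0, h.self, h.lft_zero, mul_one] at this
  exact this.symm

/-- The holonomy of a loop. -/
noncomputable def hol (τ : X → X → G) {x : X} (γ : Path x x) : G := lft τ γ.toContinuousMap 1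

theorem IsCocycle.hol_close {R : X → X → Prop} {τ : X → X → G} (h : IsCocycle R τ) {x : X}
    {α β : Path x x} (hR : ∀ s, R (α s) (β s)) : hol τ β = hol τ α := by
  have := h.lft_close (α := α.toContinuousMap) (β := β.toContinuousMap) hR (by simp) 1
  simpa [h.self, hol] using this

theorem IsCocycle.hol_eventually {R : X → X → Prop} {τ : X → X → G} (h : IsCocycle R τ) {x : X}
    (α : Path x x) : ∀ᶠ β : Path x x in 𝓝 α, ∀ s, R (α s) (β s) := by
  have hc : Continuous fun β : Path x x => β.toContinuousMap := continuous_induced_dom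
  exact hc.continuousAt.eventually (h.eventually_close α.toContinuousMap)

theorem IsCocycle.hol_homotopic {R : X → X → Prop} {τ : X → X → G} (h : IsCocycle R τ) {x : X}
    {α β : Path x x} (hab : α.Homotopic β) : hol τ α = hol τ β := by
  obtain ⟨F⟩ := hab
  have hF : Continuous fun u : I => F.eval u := by
    rw [← Path.continuous_uncurry_iff]
    exact F.continuous
  have := pred_const (P := fun u => hol τ (F.eval u) = hol τ α) ?_ (a := 0) (by simp) 1
  · simpa using this.symm
  · intro u
    filter_upwards [hF.continuousAt.eventually (h.hol_eventually (F.eval u))] with v hv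
    rw [h.hol_close hv]

theorem IsCocycle.hol_trans {R : X → X → Prop} {τ : X → X → G} (h : IsCocycle R τ) {x : X}
    (α β : Path x x) : hol τ (α.trans β) = hol τ β * hol τ α := by
  set g := lft τ (α.trans β).toContinuousMap with hgdef
  have hg : IsLift τ _ g := h.lft_isLift (α.trans β).toContinuousMap
  have hg0 : g 0 = 1 := h.lft_zero _
  let a : I → I := fun s => ⟨s / 2, by constructor <;> linarith [s.2.1, s.2.2]⟩
  let b : I → I := fun s => ⟨(1 + s) / 2, by constructor <;> linarith [s.2.1, s.2.2]⟩
  have ha : Continuous a := by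
    apply Continuous.subtype_mk; fun_prop
  have hb : Continuous b := by
    apply Continuous.subtype_mk; fun_prop
  have hαa : ∀ s, (α.trans β) (a s) = α s := by
    intro s
    rw [Path.trans_apply, dif_pos (by simp only [a]; linarith [s.2.2])]
    congr 1; ext; simp only [a]; ring
  have hβb : ∀ s, (α.trans β) (b s) = β s := by
    intro s
    rw [Path.trans_apply]
    split_ifs with hs
    · have : (s : ℝ) = 0 := by
        have := s.2.1
        simp only [b] at hs
        linarith
      have hs0 : s = 0 := by ext; simpa using this
      subst hs0
      rw [β.source]
      convert α.target
      simp [b]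
    · congr 1; ext; simp only [b]; ring
  have h1 : IsLift τ α.toContinuousMap (fun s => g (a s)) := by
    intro s
    filter_upwards [ha.continuousAt.eventually (hg (a s))] with t ht
    rw [ht]
    simp [hαa]
  have h2 : IsLift τ β.toContinuousMap (fun s => g (b s)) := by
    intro s
    filter_upwards [hb.continuousAt.eventually (hg (b s))] with t ht
    rw [ht]
    simp [hβb]
  have e1 := h.eq_lft h1 1
  have e2 := h.eq_lft h2 1
  have a0 : a 0 = 0 := by ext; simp [a]
  have ab : b 0 = a 1 := by ext; simp [a, b]
  have b1 : b 1 = 1 := by ext; simp only [b]; norm_num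
  simp only [a0, hg0, mul_one] at e1
  simp only [ab, b1, e1] at e2
  exact e2

end Cocycle

end HE

namespace HE

open Set Filter Topology unitInterval

/-- representative in `[-1/2, 1/2)` -/
noncomputable def rep (z : UnitAddCircle) : ℝ := (AddCircle.equivIco (1 : ℝ) (-1/2) z : ℝ)

theorem rep_coe (z : UnitAddCircle) : ((rep z : ℝ) : UnitAddCircle) = z :=
  AddCircle.coe_equivIco

theorem rep_mem (z : UnitAddCircle) : -1/2 ≤ rep z ∧ rep z < 1/2 := by
  have := (AddCircle.equivIco (1 : ℝ) (-1/2) z).2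
  constructor
  · exact this.1
  · have := this.2
    simp only [rep]
    linarith

theorem rep_zero : rep 0 = 0 := by
  have : ((0 : ℝ) : UnitAddCircle) = 0 := by simp
  rw [rep, ← this, AddCircle.equivIco_coe_eq (by constructor <;> norm_num)]

theorem rep_eq_zero {z : UnitAddCircle} : rep z = 0 ↔ z = 0 := by
  constructor
  · intro h
    rw [← rep_coe z, h]; simp
  · rintro rfl; exact rep_zero

/-- crossing number between nearby points of the circle -/
noncomputable def crs (z w : UnitAddCircle) : ℤ := round (rep z - rep w)

theorem norm_sub_eq (z w : UnitAddCircle) : ‖z - w‖ = |rep w + crs z w - rep z| := by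
  conv_lhs => rw [← rep_coe z, ← rep_coe w]
  rw [← AddCircle.coe_sub, UnitAddCircle.norm_eq, abs_sub_comm]
  congr 1
  simp only [crs]; ring

theorem crs_self (z : UnitAddCircle) : crs z z = 0 := by simp [crs]

theorem crs_abs_le {z w : UnitAddCircle} : |crs z w| ≤ 1 := by
  have h1 := rep_mem z
  have h2 := rep_mem w
  have h3 := abs_le.1 (abs_sub_round (rep z - rep w))
  have : (crs z w : ℝ) = round (rep z - rep w) := rfl
  have a : (crs z w : ℝ) < 2 := by rw [this]; linarith
  have b : (-2 : ℝ) < crs z w := by rw [this]; linarith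
  have a' : crs z w < 2 := by exact_mod_cast a
  have b' : -2 < crs z w := by exact_mod_cast b
  rw [abs_le]; constructor <;> omega

theorem int_eq_zero_of_abs_lt {m : ℤ} (h : |(m : ℝ)| < 1) : m = 0 := by
  have : |m| < 1 := by exact_mod_cast h
  exact Int.abs_lt_one_iff.1 this

theorem crs_add {x y z : UnitAddCircle} (h1 : ‖x - y‖ < 1/4) (h2 : ‖y - z‖ < 1/4)
    (h3 : ‖x - z‖ < 1/4) : crs y z + crs x y = crs x z := by
  rw [norm_sub_eq, abs_lt] at h1 h2 h3
  have : crs y z + crs x y - crs x z = 0 := by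
    apply int_eq_zero_of_abs_lt
    push_cast
    rw [abs_lt]
    constructor <;> linarith [h1.1, h1.2, h2.1, h2.2, h3.1, h3.2]
  omega

theorem crs_zero_left {y : UnitAddCircle} (h1 : ‖(0 : UnitAddCircle) - y‖ < 1/4) : crs 0 y = 0 := by
  rw [norm_sub_eq, abs_lt, rep_zero] at h1
  have := rep_mem y
  apply int_eq_zero_of_abs_lt
  rw [abs_lt]
  constructor <;> linarith [h1.1, h1.2, this.1, this.2]

theorem crs_zero_right {x : UnitAddCircle} (h1 : ‖x - (0 : UnitAddCircle)‖ < 1/4) : crs x 0 = 0 := by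
  rw [norm_sub_eq, abs_lt, rep_zero] at h1
  have := rep_mem x
  apply int_eq_zero_of_abs_lt
  rw [abs_lt]
  constructor <;> linarith [h1.1, h1.2, this.1, this.2]

abbrev F := FreeGroup ℕ

/-- ordered product of powers of the first `n+1` generators -/
noncomputable def sing (n : ℕ) (m : ℕ → ℤ) : F :=
  ((List.range (n + 1)).map fun i => (FreeGroup.of i : F) ^ (m i)).prod

theorem sing_succ (n : ℕ) (m : ℕ → ℤ) : sing (n + 1) m = sing n m * FreeGroup.of (n+1) ^ m (n+1) := by
  simp [sing, List.range_succ, mul_assoc]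

theorem sing_one {n : ℕ} {m : ℕ → ℤ} (h : ∀ j ≤ n, m j = 0) : sing n m = 1 := by
  induction n with
  | zero => simp [sing, h 0 le_rfl]
  | succ n ih =>
    rw [sing_succ, ih (fun j hj => h j (by omega)), h _ le_rfl]; simp

theorem sing_single {n i : ℕ} {m : ℕ → ℤ} (hi : i ≤ n) (h : ∀ j ≤ n, j ≠ i → m j = 0) :
    sing n m = FreeGroup.of i ^ m i := by
  induction n with
  | zero =>
    obtain rfl : i = 0 := by omega
    simp [sing]
  | succ n ih =>
    rw [sing_succ]
    by_cases hin : i = n + 1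
    · subst hin
      rw [sing_one (fun j hj => h j (by omega) (by omega))]; simp
    · rw [ih (by omega) (fun j hj => h j (by omega)), h (n+1) le_rfl (by omega)]; simp

section Data

variable {X : Type*} [TopologicalSpace X]

/-- The circle coordinates of an earring-like space. -/
structure Earring (X : Type*) [TopologicalSpace X] where
  q : ℕ → C(X, UnitAddCircle)
  disj : ∀ x i j, i ≠ j → q i x ≠ 0 → q j x = 0
  inj : ∀ x y, (∀ i, q i x = q i y) → x = y

variable (D : Earring X)

/-- closeness -/
def Earring.R (n : ℕ) (x y : X) : Prop := ∀ i ≤ n, ‖D.q i x - D.q i y‖ < 1/4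

/-- the cocycle -/
noncomputable def Earring.τ (n : ℕ) (x y : X) : F := sing n (fun i => crs (D.q i x) (D.q i y))

theorem Earring.R_mono {m n : ℕ} (h : m ≤ n) {x y : X} (hR : D.R n x y) : D.R m x y :=
  fun i hi => hR i (hi.trans h)

theorem Earring.crs_other {n i j : ℕ} {x y : X} (hR : D.R n x y) (hi : i ≤ n)
    (h : D.q i x ≠ 0 ∨ D.q i y ≠ 0) (hj : j ≤ n) (hij : j ≠ i) : crs (D.q j x) (D.q j y) = 0 := by
  rcases h with h | h
  · have := D.disj x i j hij.symm h
    have hh := hR j hj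
    rw [this] at hh ⊢
    exact crs_zero_left hh
  · have := D.disj y i j hij.symm h
    have hh := hR j hj
    rw [this] at hh ⊢
    exact crs_zero_right hh

theorem Earring.ne_of_crs {n i : ℕ} {x y : X} (hR : D.R n x y) (hi : i ≤ n)
    (h : crs (D.q i x) (D.q i y) ≠ 0) : D.q i x ≠ 0 ∧ D.q i y ≠ 0 := by
  have hh := hR i hi
  constructor
  · intro h0
    rw [h0] at h hh
    exact h (crs_zero_left hh)
  · intro h0
    rw [h0] at h hh
    exact h (crs_zero_right hh)

theorem Earring.cocycle (n : ℕ) : IsCocycle (D.R n) (D.τ n) where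
  isOpen := by
    have : {p : X × X | D.R n p.1 p.2} =
        ⋂ i ∈ Finset.range (n+1), {p : X × X | ‖D.q i p.1 - D.q i p.2‖ < 1/4} := by
      ext p
      simp [Earring.R]
    rw [this]
    apply isOpen_biInter_finset
    intro i _
    apply isOpen_lt <;> fun_prop
  refl x i _ := by simp
  symm x y h i hi := by rw [norm_sub_rev]; exact h i hi
  coc x y z h1 h2 h3 := by
    have hadd : ∀ j ≤ n, crs (D.q j y) (D.q j z) + crs (D.q j x) (D.q j y)
        = crs (D.q j x) (D.q j z) := fun j hj => crs_add (h1 j hj) (h2 j hj) (h3 j hj)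
    by_cases h : ∃ i ≤ n, D.q i y ≠ 0
    · obtain ⟨i, hi, hy⟩ := h
      have a1 : ∀ j ≤ n, j ≠ i → crs (D.q j x) (D.q j y) = 0 := fun j hj hij =>
        D.crs_other h1 hi (Or.inr hy) hj hij
      have a2 : ∀ j ≤ n, j ≠ i → crs (D.q j y) (D.q j z) = 0 := fun j hj hij =>
        D.crs_other h2 hi (Or.inl hy) hj hij
      have a3 : ∀ j ≤ n, j ≠ i → crs (D.q j x) (D.q j z) = 0 := fun j hj hij => by
        rw [← hadd j hj, a1 j hj hij, a2 j hj hij]; rfl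
      rw [Earring.τ, Earring.τ, Earring.τ, sing_single hi a1, sing_single hi a2, sing_single hi a3,
        ← zpow_add, hadd i hi]
    · push Not at h
      have a1 : ∀ j ≤ n, crs (D.q j x) (D.q j y) = 0 := fun j hj => by
        by_contra hc
        exact (D.ne_of_crs h1 hj hc).2 (h j hj)
      have a2 : ∀ j ≤ n, crs (D.q j y) (D.q j z) = 0 := fun j hj => by
        by_contra hc
        exact (D.ne_of_crs h2 hj hc).1 (h j hj)
      have a3 : ∀ j ≤ n, crs (D.q j x) (D.q j z) = 0 := fun j hj => by
        rw [← hadd j hj, a1 j hj, a2 j hj]; rfl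
      rw [Earring.τ, Earring.τ, Earring.τ, sing_one a1, sing_one a2, sing_one a3, one_mul]

/-- The cocycle takes values in powers of a single generator. -/
theorem Earring.τ_single {n : ℕ} {x y : X} (hR : D.R n x y) :
    ∃ (i : ℕ) (c : ℤ), |c| ≤ 1 ∧ ∀ m ≤ n, D.τ m x y = if i ≤ m then FreeGroup.of i ^ c else 1 := by
  by_cases h : ∃ i ≤ n, crs (D.q i x) (D.q i y) ≠ 0
  · obtain ⟨i, hi, hc⟩ := h
    have hne := D.ne_of_crs hR hi hc
    refine ⟨i, crs (D.q i x) (D.q i y), crs_abs_le, fun m hm => ?_⟩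
    have a1 : ∀ j ≤ n, j ≠ i → crs (D.q j x) (D.q j y) = 0 := fun j hj hij =>
      D.crs_other hR hi (Or.inl hne.1) hj hij
    split_ifs with him
    · exact sing_single him (fun j hj => a1 j (by omega))
    · exact sing_one (fun j hj => a1 j (by omega) (by omega))
  · push Not at h
    refine ⟨0, 0, by simp, fun m hm => ?_⟩
    rw [Earring.τ, sing_one (fun j hj => h j (by omega))]
    simp

/-- the lift in the free group -/
noncomputable def Earring.g (n : ℕ) (α : C(I, X)) : I → F := lft (D.τ n) α

/-- kill generators above `n` -/
noncomputable def kill (n : ℕ) : F →* F := FreeGroup.lift (fun i => if i ≤ n then FreeGroup.of i else 1)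

theorem kill_of_zpow (n i : ℕ) (c : ℤ) :
    kill n (FreeGroup.of i ^ c) = if i ≤ n then FreeGroup.of i ^ c else 1 := by
  rw [map_zpow, kill, FreeGroup.lift_apply_of]
  split_ifs <;> simp

theorem Earring.g_zero (n : ℕ) (α : C(I, X)) : D.g n α 0 = 1 := (D.cocycle n).lft_zero α

theorem Earring.g_lift (n : ℕ) (α : C(I, X)) (s : I) :
    ∀ᶠ t in 𝓝 s, D.g n α t = D.τ n (α s) (α t) * D.g n α s := (D.cocycle n).lft_isLift α s

theorem Earring.eventually_R (n : ℕ) (α : C(I, X)) (s : I) :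
    ∀ᶠ t in 𝓝 s, D.R n (α s) (α t) :=
  (D.cocycle n).eventually_R (s := s) (continuous_const (y := α s)) α.continuous
    ((D.cocycle n).refl _)

theorem Earring.kill_g {m n : ℕ} (h : m ≤ n) (α : C(I, X)) (s : I) :
    kill m (D.g n α s) = D.g m α s := by
  refine pred_const (P := fun s => kill m (D.g n α s) = D.g m α s) ?_ (a := 0)
    (by simp [D.g_zero]) s
  intro s
  filter_upwards [D.g_lift n α s, D.g_lift m α s, D.eventually_R n α s] with t h1 h2 h3
  obtain ⟨i, c, -, hc⟩ := D.τ_single h3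
  rw [h1, h2, hc n le_rfl, hc m h, map_mul]
  have : kill m (if i ≤ n then FreeGroup.of i ^ c else 1) = if i ≤ m then FreeGroup.of i ^ c else 1 := by
    by_cases hin : i ≤ n
    · rw [if_pos hin, kill_of_zpow]
    · rw [if_neg hin, if_neg (by omega), map_one]
  rw [this, mul_right_inj]

end Data

end HE

namespace HE

open Set Filter Topology unitInterval

/-- exponent sum of the generator `i` -/
noncomputable def exh (i : ℕ) : F →* Multiplicative ℤ :=
  FreeGroup.lift (fun j => Multiplicative.ofAdd (if j = i then 1 else 0))

noncomputable def ex (i : ℕ) (y : F) : ℤ := (exh i y).toAdd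

theorem ex_mul (i : ℕ) (a b : F) : ex i (a * b) = ex i a + ex i b := by simp [ex]
theorem ex_one (i : ℕ) : ex i 1 = 0 := by simp [ex]
theorem ex_inv (i : ℕ) (a : F) : ex i a⁻¹ = - ex i a := by simp [ex]
theorem ex_of (i j : ℕ) : ex i (FreeGroup.of j) = if j = i then 1 else 0 := by simp [ex, exh]
theorem ex_zpow (i : ℕ) (a : F) (c : ℤ) : ex i (a ^ c) = c * ex i a := by simp [ex]

theorem ex_kill {i m : ℕ} (h : i ≤ m) (y : F) : ex i (kill m y) = ex i y := by
  have : (exh i).comp (kill m) = exh i := by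
    ext j
    simp only [MonoidHom.comp_apply, kill, FreeGroup.lift_apply_of, exh]
    split_ifs <;> simp_all
  exact congrArg Multiplicative.toAdd (DFunLike.congr_fun this y)

/-- the elementary permutations -/
noncomputable def S (i : ℕ) : Equiv.Perm F where
  toFun y := if (i : ℤ) ≤ |ex 0 y| then FreeGroup.of i * y else y
  invFun y := if (i : ℤ) ≤ |ex 0 y| then (FreeGroup.of i)⁻¹ * y else y
  left_inv y := by
    by_cases hi : i = 0
    · subst hi; simp
    · have : ex 0 (FreeGroup.of i * y) = ex 0 y := by rw [ex_mul, ex_of, if_neg hi, zero_add]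
      by_cases h : (i : ℤ) ≤ |ex 0 y|
      · simp [h, this]
      · simp [h]
  right_inv y := by
    by_cases hi : i = 0
    · subst hi; simp
    · have : ex 0 ((FreeGroup.of i)⁻¹ * y) = ex 0 y := by
        rw [ex_mul, ex_inv, ex_of, if_neg hi]; simp
      by_cases h : (i : ℤ) ≤ |ex 0 y|
      · simp [h, this]
      · simp [h]

/-- the action -/
noncomputable def T : F →* Equiv.Perm F := FreeGroup.lift S

theorem T_letter (i : ℕ) {c : ℤ} (hc : |c| ≤ 1) (y : F) :
    T (FreeGroup.of i ^ c) y = if (i : ℤ) ≤ |ex 0 y| then FreeGroup.of i ^ c * y else y := by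
  rw [map_zpow, T, FreeGroup.lift_apply_of]
  rw [abs_le] at hc
  obtain h | h | h : c = -1 ∨ c = 0 ∨ c = 1 := by omega
  · subst h
    rw [zpow_neg_one, zpow_neg_one]; rfl
  · subst h; simp
  · subst h
    rw [zpow_one, zpow_one]; rfl

theorem T_zero (c : ℕ) (y : F) : T (FreeGroup.of 0 ^ c) y = FreeGroup.of 0 ^ c * y := by
  induction c with
  | zero => simp
  | succ c ih =>
    rw [pow_succ', map_mul, Equiv.Perm.mul_apply, ih]
    have := T_letter 0 (c := 1) (by simp) (FreeGroup.of 0 ^ c * y)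
    rw [zpow_one, if_pos (by simp)] at this
    rw [this, mul_assoc]

theorem ex_T (g y : F) : ex 0 (T g y) = ex 0 g + ex 0 y := by
  have h1 : ∀ (i : ℕ) (c : ℤ) (_ : |c| ≤ 1) (y : F),
      ex 0 (T (FreeGroup.of i ^ c) y) = ex 0 (FreeGroup.of i ^ c) + ex 0 y := by
    intro i c hc y
    rw [T_letter i hc]
    split_ifs with h
    · rw [ex_mul]
    · have : i ≠ 0 := by rintro rfl; simp at h
      rw [ex_zpow, ex_of, if_neg this]; simp
  induction g using FreeGroup.induction_on generalizing y with
  | C1 => simp [ex_one]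
  | of i => simpa using h1 i 1 (by simp) y
  | inv_of i _ => simpa using h1 i (-1) (by simp) y
  | mul a b ha hb => rw [map_mul, Equiv.Perm.mul_apply, ha, hb, ex_mul, add_assoc]

section Data

variable {X : Type*} [TopologicalSpace X] (D : Earring X)

theorem Earring.ex_g (n : ℕ) (α : C(I, X)) (s : I) : ex 0 (D.g n α s) = ex 0 (D.g 0 α s) := by
  rw [← D.kill_g (Nat.zero_le n), ex_kill le_rfl]

theorem Earring.ex_τ_le {x y : X} (h : D.R 0 x y) : |ex 0 (D.τ 0 x y)| ≤ 1 := by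
  obtain ⟨i, c, hc, hτ⟩ := D.τ_single h
  rw [hτ 0 le_rfl]
  split_ifs with hi
  · obtain rfl : i = 0 := by omega
    simpa [ex_zpow, ex_of] using hc
  · simp [ex_one]

theorem Earring.exists_bound (α : C(I, X)) : ∃ B : ℕ, ∀ s, |ex 0 (D.g 0 α s)| ≤ B := by
  have := (isCompact_univ : IsCompact (univ : Set I)).induction_on
    (p := fun A => ∃ B : ℕ, ∀ s ∈ A, |ex 0 (D.g 0 α s)| ≤ B) ⟨0, by simp⟩
    (fun A A' hA ⟨B, hB⟩ => ⟨B, fun s hs => hB s (hA hs)⟩)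
    (fun A A' ⟨B, hB⟩ ⟨B', hB'⟩ => ⟨max B B', by
      rintro s (hs | hs)
      · exact (hB s hs).trans (by simp)
      · exact (hB' s hs).trans (by simp)⟩)
    (fun s _ => by
      refine ⟨{t | |ex 0 (D.g 0 α t)| ≤ ((ex 0 (D.g 0 α s)).natAbs + 1 : ℕ)}, ?_, _, fun t ht => ht⟩
      rw [nhdsWithin_univ]
      filter_upwards [D.g_lift 0 α s, D.eventually_R 0 α s] with t h1 h2
      have h3 := D.ex_τ_le h2
      have h4 := abs_add_le (ex 0 (D.τ 0 (α s) (α t))) (ex 0 (D.g 0 α s))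
      simp only [h1, ex_mul]
      push_cast
      omega)
  obtain ⟨B, hB⟩ := this
  exact ⟨B, fun s => hB s (mem_univ s)⟩

theorem Earring.stable {α : C(I, X)} {v : F} {B N N' : ℕ}
    (hB : ∀ s, |ex 0 (D.g 0 α s) + ex 0 v| ≤ B) (h1 : B ≤ N) (h2 : N ≤ N') (s : I) :
    T (D.g N α s) v = T (D.g N' α s) v := by
  refine pred_const (P := fun s => T (D.g N α s) v = T (D.g N' α s) v) ?_ (a := 0)
    (by simp [D.g_zero]) s
  intro s
  filter_upwards [D.g_lift N α s, D.g_lift N' α s, D.eventually_R N' α s] with t a1 a2 a3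
  obtain ⟨i, c, hc, hτ⟩ := D.τ_single a3
  rw [a1, a2, hτ N h2, hτ N' le_rfl, map_mul, map_mul, Equiv.Perm.mul_apply, Equiv.Perm.mul_apply]
  by_cases hi : i ≤ N
  · rw [if_pos hi, if_pos (hi.trans h2)]
    exact (T (FreeGroup.of i ^ c)).injective.eq_iff
  · rw [if_neg hi]
    by_cases hi' : i ≤ N'
    · rw [if_pos hi', T_letter i hc, if_neg, map_one, Equiv.Perm.one_apply]
      rw [ex_T, D.ex_g]
      have := hB s
      omega
    · rw [if_neg hi', map_one, Equiv.Perm.one_apply, Equiv.Perm.one_apply]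

theorem Earring.kill_T {α : C(I, X)} {v : F} {n N : ℕ} (hn : n ≤ N)
    (hB : ∀ s, n ≤ |ex 0 (D.g 0 α s) + ex 0 v|) (s : I) :
    kill n (T (D.g N α s) v) = D.g n α s * kill n v := by
  refine pred_const (P := fun s => kill n (T (D.g N α s) v) = D.g n α s * kill n v) ?_ (a := 0)
    (by simp [D.g_zero]) s
  intro s
  filter_upwards [D.g_lift N α s, D.g_lift n α s, D.eventually_R N α s] with t a1 a2 a3
  obtain ⟨i, c, hc, hτ⟩ := D.τ_single a3
  rw [a1, a2, hτ N le_rfl, hτ n hn, map_mul, Equiv.Perm.mul_apply]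
  by_cases hi : i ≤ n
  · rw [if_pos hi, if_pos (hi.trans hn), T_letter i hc, if_pos, map_mul, kill_of_zpow, if_pos hi,
      mul_assoc, mul_right_inj]
    rw [ex_T, D.ex_g]
    have := hB s
    omega
  · rw [if_neg hi, one_mul]
    by_cases hi' : i ≤ N
    · rw [if_pos hi', T_letter i hc]
      split_ifs with h
      · rw [map_mul, kill_of_zpow, if_neg hi, one_mul]
      · rfl
    · rw [if_neg hi', map_one, Equiv.Perm.one_apply]

variable {x : X}

/-- the homomorphism from the fundamental group to the free group -/
noncomputable def Earring.H (x : X) (n : ℕ) : FundamentalGroup X x →* F where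
  toFun a := Quotient.lift (s := Path.Homotopic.setoid x x) (hol (D.τ n))
    (fun _ _ h => (D.cocycle n).hol_homotopic h) a
  map_one' := by
    change hol (D.τ n) (Path.refl x) = 1
    have h := (D.cocycle n).hol_trans (Path.refl x) (Path.refl x)
    rw [Path.refl_trans_refl] at h
    simpa using h
  map_mul' a b := by
    induction a using Quotient.inductionOn
    induction b using Quotient.inductionOn
    exact (D.cocycle n).hol_trans _ _

theorem Earring.H_class (n : ℕ) (γ : Path x x) : D.H x n (pathClass γ) = hol (D.τ n) γ := rfl

theorem Earring.hol_eq (n : ℕ) (γ : Path x x) : hol (D.τ n) γ = D.g n γ.toContinuousMap 1 := rfl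

theorem pathClass_surj (a : FundamentalGroup X x) : ∃ γ : Path x x, pathClass γ = a :=
  Quotient.exists_rep a

theorem pathClass_trans (γ δ : Path x x) :
    pathClass (γ.trans δ) = pathClass δ * pathClass γ := rfl

theorem pathClass_symm (γ : Path x x) : pathClass γ.symm = (pathClass γ)⁻¹ := rfl

theorem pathClass_eq_one {γ : Path x x} (h : γ.Homotopic (Path.refl x)) : pathClass γ = 1 :=
  Quotient.sound h

/-- the subgroup -/
noncomputable def Earring.K (x : X) : Subgroup (FundamentalGroup X x) where
  carrier := {a | ∀ᶠ N in atTop, T (D.H x N a) 1 = 1}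
  one_mem' := by
    refine Eventually.of_forall fun N => ?_
    rw [(D.H x N).map_one, T.map_one]; rfl
  mul_mem' {a b} ha hb := by
    filter_upwards [ha, hb] with N h1 h2
    rw [map_mul, map_mul, Equiv.Perm.mul_apply, h2, h1]
  inv_mem' {a} ha := by
    filter_upwards [ha] with N h1
    rw [map_inv, map_inv, Equiv.Perm.inv_eq_iff_eq, h1]

theorem Earring.mem_K {a : FundamentalGroup X x} :
    a ∈ D.K x ↔ ∀ᶠ N in atTop, T (D.H x N a) 1 = 1 := Iff.rfl

theorem Earring.K_open : IsOpen {γ : Path x x | pathClass γ ∈ D.K x} := by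
  rw [isOpen_iff_mem_nhds]
  intro α hα
  obtain ⟨B, hB⟩ := D.exists_bound α.toContinuousMap
  filter_upwards [(D.cocycle (B+1)).hol_eventually α] with β hβ
  have hβ0 : ∀ s, D.R 0 (α s) (β s) := fun s => D.R_mono (Nat.zero_le _) (hβ s)
  have hB' : ∀ s, |ex 0 (D.g 0 β.toContinuousMap s)| ≤ (B + 1 : ℕ) := by
    intro s
    have := (D.cocycle 0).lft_close (α := α.toContinuousMap) (β := β.toContinuousMap) hβ0 (by simp) s
    rw [Earring.g, this, ex_mul]
    have h1 := D.ex_τ_le (hβ0 s)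
    have h2 := hB s
    have h4 := abs_add_le (ex 0 (D.τ 0 (α s) (β s))) (ex 0 (D.g 0 α.toContinuousMap s))
    push_cast
    have h5 : |ex 0 (D.τ 0 (α s) (β s)) + (ex 0 (D.g 0 α.toContinuousMap s))| ≤ B + 1 := by omega
    exact h5
  have hBα : ∀ s, |ex 0 (D.g 0 α.toContinuousMap s)| ≤ (B + 1 : ℕ) := fun s => by
    have := hB s
    push_cast; omega
  have e := (D.cocycle (B+1)).hol_close hβ
  replace hα := D.mem_K.1 hα
  refine D.mem_K.2 ?_
  filter_upwards [hα, eventually_ge_atTop (B+1)] with N h1 h2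
  rw [D.H_class, D.hol_eq] at h1 ⊢
  rw [← D.stable (B := B + 1) (by simpa [ex_one] using hB') le_rfl h2]
  rw [← D.stable (B := B + 1) (by simpa [ex_one] using hBα) le_rfl h2] at h1
  rw [D.hol_eq, D.hol_eq] at e
  rw [e, h1]

theorem Earring.core_H (ℓ : FundamentalGroup X x) (hℓ : ∀ n, D.H x n ℓ = FreeGroup.of 0)
    {N : Subgroup (FundamentalGroup X x)} (hN : N.Normal) (hNK : N ≤ D.K x)
    {a : FundamentalGroup X x} (ha : a ∈ N) (n : ℕ) : D.H x n a = 1 := by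
  obtain ⟨γ, rfl⟩ := pathClass_surj a
  obtain ⟨B, hB⟩ := D.exists_bound γ.toContinuousMap
  set j := n + B with hj
  have h1 : (ℓ ^ j)⁻¹ * pathClass γ * ℓ ^ j ∈ D.K x := by
    have := hN.conj_mem _ ha (ℓ ^ j)⁻¹
    rw [inv_inv] at this
    exact hNK this
  rw [D.mem_K] at h1
  obtain ⟨M, hM, hM'⟩ := (h1.and (eventually_ge_atTop n)).exists
  have hc : D.H x M ((ℓ ^ j)⁻¹ * pathClass γ * ℓ ^ j) =
      (FreeGroup.of 0 ^ j)⁻¹ * D.H x M (pathClass γ) * FreeGroup.of 0 ^ j := by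
    rw [map_mul, map_mul, map_inv, map_pow, hℓ]
  rw [hc, map_mul, map_mul, map_inv, Equiv.Perm.mul_apply,
    Equiv.Perm.mul_apply, Equiv.Perm.inv_eq_iff_eq, T_zero, mul_one] at hM
  have h2 := D.kill_T (α := γ.toContinuousMap) (v := FreeGroup.of 0 ^ j) hM' ?_ 1
  · rw [← D.hol_eq, ← D.hol_eq, ← D.H_class, ← D.H_class, hM] at h2
    simpa using h2.symm
  · intro s
    have h3 : ex 0 (FreeGroup.of 0 ^ j : F) = j := by
      have := ex_zpow 0 (FreeGroup.of 0) j
      simpa [ex_of] using this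
    have := abs_le.1 (hB s)
    rw [h3, le_abs]
    left
    push_cast [hj]
    omega

end Data
end HE

namespace HE

open Set Filter Topology unitInterval

/-- ancestors at height `u` -/
def IsAnc (f : I → ℝ) (u : ℝ) (s r : I) : Prop :=
  r ≤ s ∧ f r = min u (f s) ∧ ∀ x, min u (f s) ≤ f (max r (min x s))

theorem IsAnc.exists {f : I → ℝ} (hf : Continuous f) (h0 : f 0 = 0) {u : ℝ} (hu : 0 ≤ u) (s : I) :
    ∃ r, IsAnc f u s r := by
  have hne : ({r : I | r ≤ s ∧ f r ≤ u}).Nonempty := ⟨0, s.2.1, by rw [h0]; exact hu⟩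
  have hcl : IsClosed {r : I | r ≤ s ∧ f r ≤ u} :=
    (isClosed_le continuous_id continuous_const).inter (isClosed_le hf continuous_const)
  obtain ⟨a, ⟨has, hau⟩, hmax⟩ := hcl.isCompact.exists_isGreatest hne
  have hgt : ∀ r, a < r → r ≤ s → u < f r := by
    intro r h1 h2
    by_contra h3
    exact absurd (hmax (show r ∈ {r : I | r ≤ s ∧ f r ≤ u} from ⟨h2, not_lt.1 h3⟩)) (not_le.2 h1)
  have hfa : f a = min u (f s) := by
    rcases eq_or_lt_of_le has with h | h
    · rw [← h, min_eq_right hau]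
    · rw [min_eq_left (hgt s h le_rfl).le]
      by_contra hne
      have hlt : f a < u := lt_of_le_of_ne hau hne
      have hev : ∀ᶠ r in 𝓝[>] a, f r < u ∧ r < s ∧ a < r := by
        have e1 : ∀ᶠ r in 𝓝[>] a, f r < u :=
          nhdsWithin_le_nhds (hf.continuousAt.eventually_lt continuousAt_const hlt)
        have e2 : ∀ᶠ r in 𝓝[>] a, r < s := nhdsWithin_le_nhds (eventually_lt_nhds h)
        filter_upwards [e1, e2, self_mem_nhdsWithin] with r a1 a2 a3
        exact ⟨a1, a2, a3⟩
      have : (𝓝[>] a).NeBot := nhdsGT_neBot_of_exists_gt ⟨s, h⟩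
      obtain ⟨r, h1, h2, h3⟩ := hev.exists
      exact absurd (hgt r h3 h2.le) (not_lt.2 h1.le)
  refine ⟨a, has, hfa, fun x => ?_⟩
  rcases eq_or_lt_of_le (le_max_left a (min x s)) with h | h
  · rw [← h, hfa]
  · exact (min_le_left _ _).trans (hgt _ h (max_le has (min_le_right _ _))).le

theorem contour_null {X : Type*} [TopologicalSpace X] {x : X} (α : Path x x) {f : I → ℝ}
    (hf : Continuous f) (hpos : ∀ s, 0 ≤ f s) (h0 : f 0 = 0) (h1 : f 1 = 0)
    (hα : ∀ s t, s ≤ t → f s = f t → (∀ r, s ≤ r → r ≤ t → f s ≤ f r) → α s = α t) :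
    α.Homotopic (Path.refl x) := by
  obtain ⟨C, hC⟩ : ∃ C, ∀ s, f s ≤ C := by
    obtain ⟨C, hC⟩ := (isCompact_range hf).bddAbove
    exact ⟨C, fun s => hC (mem_range_self s)⟩
  have hC0 : 0 ≤ C := (hpos 0).trans (hC 0)
  have huniq : ∀ u s r r', IsAnc f u s r → IsAnc f u s r' → α r = α r' := by
    have key : ∀ u s r r', r ≤ r' → IsAnc f u s r → IsAnc f u s r' → α r = α r' := by
      rintro u s r r' hrr ⟨a1, a2, a3⟩ ⟨b1, b2, b3⟩
      refine hα r r' hrr (a2.trans b2.symm) fun y h1 h2 => ?_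
      have := a3 y
      rw [min_eq_left (h2.trans b1), max_eq_right h1, ← a2] at this
      exact this
    intro u s r r' h h'
    rcases le_total r r' with hh | hh
    · exact key u s r r' hh h h'
    · exact (key u s r' r hh h' h).symm
  have hex : ∀ p : I × I, ∃ r, IsAnc f (C * p.1) p.2 r := fun p =>
    IsAnc.exists hf h0 (mul_nonneg hC0 p.1.2.1) p.2
  choose anc hanc using hex
  have hZ : IsClosed {z : (I × I) × I | IsAnc f (C * z.1.1) z.1.2 z.2} := by
    have e1 : IsClosed {z : (I × I) × I | z.2 ≤ z.1.2} := isClosed_le (by fun_prop) (by fun_prop)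
    have e2 : IsClosed {z : (I × I) × I | f z.2 = min (C * (z.1.1 : ℝ)) (f z.1.2)} :=
      isClosed_eq (by fun_prop) (by fun_prop)
    have e3 : IsClosed (⋂ y : I, {z : (I × I) × I |
        min (C * (z.1.1 : ℝ)) (f z.1.2) ≤ f (max z.2 (min y z.1.2))}) :=
      isClosed_iInter fun y => isClosed_le (by fun_prop) (by fun_prop)
    convert e1.inter (e2.inter e3) using 1
    ext z
    simp only [mem_inter_iff, mem_iInter]
    exact Iff.rfl
  have hcont : Continuous fun p => α (anc p) := by
    rw [continuous_iff_isClosed]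
    intro A hA
    have : (fun p => α (anc p)) ⁻¹' A = Prod.fst '' ({z : (I × I) × I | IsAnc f (C * z.1.1) z.1.2 z.2}
        ∩ (fun z => α z.2) ⁻¹' A) := by
      ext p
      constructor
      · intro hp
        exact ⟨(p, anc p), ⟨hanc p, hp⟩, rfl⟩
      · rintro ⟨⟨p', r⟩, ⟨hz, hr⟩, rfl⟩
        have := huniq _ _ _ _ (hanc p') hz
        simp only [mem_preimage] at hr ⊢
        rw [this]; exact hr
    rw [this]
    exact isClosedMap_fst_of_compactSpace _ (hZ.inter (hA.preimage (by fun_prop)))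
  have h00 : ∀ s, α (anc (0, s)) = x := by
    intro s
    have : IsAnc f (C * ((0 : I) : ℝ)) s 0 := by
      refine ⟨s.2.1, ?_, fun y => ?_⟩
      · simp [h0, hpos s]
      · simpa [hpos s] using hpos _
    rw [huniq _ _ _ _ (hanc (0, s)) this, α.source]
  have h11 : ∀ s, α (anc (1, s)) = α s := by
    intro s
    refine huniq _ _ _ _ (hanc (1, s)) ⟨le_rfl, ?_, fun y => ?_⟩
    · simp [hC s]
    · simp [hC s]
  have hs0 : ∀ u, α (anc (u, 0)) = x := by
    intro u
    have : anc (u, 0) = 0 := le_antisymm (hanc (u, 0)).1 (anc (u, 0)).2.1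
    rw [this, α.source]
  have hs1 : ∀ u, α (anc (u, 1)) = x := by
    intro u
    have h : 0 ≤ C * (u : ℝ) := mul_nonneg hC0 u.2.1
    have : IsAnc f (C * u) 1 1 := by
      refine ⟨le_rfl, ?_, fun y => ?_⟩
      · simp [h1, h]
      · rw [max_eq_left (min_le_right _ _), h1]; exact min_le_right _ _
    rw [huniq _ _ _ _ (hanc (u, 1)) this, α.target]
  refine Path.Homotopic.symm ⟨⟨⟨⟨fun p => α (anc p), hcont⟩, ?_, ?_⟩, ?_⟩⟩
  · intro s; simpa using h00 s
  · intro s; simpa using h11 s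
  · rintro u s (rfl | rfl)
    · simpa using hs0 u
    · simpa using hs1 u

end HE

namespace HE

open Set Filter Topology unitInterval

/-- number of letters with index `i` in a word -/
def wc (i : ℕ) (L : List (ℕ × Bool)) : ℕ := L.countP (fun p => decide (p.1 = i))

/-- number of letters with index `i` in the reduced word -/
def cnt (i : ℕ) (a : F) : ℕ := wc i a.toWord

theorem wc_append (i : ℕ) (L L' : List (ℕ × Bool)) : wc i (L ++ L') = wc i L + wc i L' :=
  List.countP_append

theorem cnt_one (i : ℕ) : cnt i 1 = 0 := by simp [cnt, wc]

theorem cnt_mul (i : ℕ) (a b : F) : cnt i (a * b) ≤ cnt i a + cnt i b := by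
  rw [cnt, cnt, cnt, ← wc_append]
  exact (FreeGroup.toWord_mul_sublist a b).countP_le

theorem cnt_inv (i : ℕ) (a : F) : cnt i a⁻¹ = cnt i a := by
  rw [cnt, cnt, FreeGroup.toWord_inv, FreeGroup.invRev, wc, wc, List.countP_reverse, List.countP_map]
  rfl

theorem cnt_of (i j : ℕ) : cnt i (FreeGroup.of j) = if j = i then 1 else 0 := by
  rw [cnt, FreeGroup.toWord_of, wc]
  by_cases h : j = i <;> simp [h]

theorem cnt_pow (i : ℕ) (a : F) (k : ℕ) : cnt i (a ^ k) ≤ k * cnt i a := by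
  induction k with
  | zero => simp [cnt_one]
  | succ k ih =>
    rw [pow_succ]
    have := cnt_mul i (a ^ k) a
    rw [add_mul, one_mul]
    omega

theorem cnt_zpow (i : ℕ) (a : F) (c : ℤ) : cnt i (a ^ c) ≤ c.natAbs * cnt i a := by
  rcases Int.natAbs_eq c with h | h
  · generalize c.natAbs = k at h
    subst h
    rw [zpow_natCast]
    exact cnt_pow i a k
  · generalize c.natAbs = k at h
    subst h
    rw [zpow_neg, cnt_inv, zpow_natCast]
    exact cnt_pow i a k

theorem cnt_of_zpow (i j : ℕ) (c : ℤ) :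
    cnt i (FreeGroup.of j ^ c) ≤ if j = i then c.natAbs else 0 := by
  have := cnt_zpow i (FreeGroup.of j) c
  rw [cnt_of] at this
  split_ifs at this ⊢ <;> simpa using this

theorem mk_cons (p : ℕ × Bool) (L : List (ℕ × Bool)) :
    (FreeGroup.mk (p :: L) : F) = FreeGroup.mk [p] * FreeGroup.mk L := by
  rw [FreeGroup.mul_mk]; rfl

theorem mk_letter (p : ℕ × Bool) :
    (FreeGroup.mk [p] : F) = FreeGroup.of p.1 ∨ (FreeGroup.mk [p] : F) = (FreeGroup.of p.1)⁻¹ := by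
  obtain ⟨j, b⟩ := p
  cases b
  · right; rfl
  · left; rfl

theorem ex_mk_le (i : ℕ) (L : List (ℕ × Bool)) : |ex i (FreeGroup.mk L)| ≤ wc i L := by
  induction L with
  | nil => simp [FreeGroup.one_eq_mk.symm, ex_one]
  | cons p L ih =>
    rw [mk_cons, ex_mul]
    have h := abs_add_le (ex i (FreeGroup.mk [p])) (ex i (FreeGroup.mk L))
    have h2 : |ex i (FreeGroup.mk [p])| ≤ if p.1 = i then 1 else 0 := by
      rcases mk_letter p with h | h <;> rw [h] <;> simp only [ex_inv, ex_of, abs_neg] <;>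
        split_ifs <;> simp
    have h3 : wc i (p :: L) = wc i L + if p.1 = i then 1 else 0 := by
      simp [wc, List.countP_cons]
    rw [h3]
    push_cast
    split_ifs at h2 ⊢ <;> omega

theorem cnt_map (i : ℕ) (φ : F →* F) (M : ℕ)
    (hφ : ∀ j, cnt i (φ (FreeGroup.of j)) ≤ if j = i then M else 0) (a : F) :
    cnt i (φ a) ≤ M * cnt i a := by
  have : ∀ L : List (ℕ × Bool), cnt i (φ (FreeGroup.mk L)) ≤ M * wc i L := by
    intro L
    induction L with
    | nil => simp [FreeGroup.one_eq_mk.symm, cnt_one]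
    | cons p L ih =>
      rw [mk_cons, map_mul]
      have h := cnt_mul i (φ (FreeGroup.mk [p])) (φ (FreeGroup.mk L))
      have h2 : cnt i (φ (FreeGroup.mk [p])) ≤ if p.1 = i then M else 0 := by
        rcases mk_letter p with h | h <;> rw [h]
        · exact hφ _
        · rw [map_inv, cnt_inv]; exact hφ _
      have h3 : wc i (p :: L) = wc i L + if p.1 = i then 1 else 0 := by
        simp [wc, List.countP_cons]
      rw [h3, mul_add]
      split_ifs at h2 ⊢ <;> omega
  have := this a.toWord
  rwa [FreeGroup.mk_toWord] at this

theorem cnt_sing (i n : ℕ) (m : ℕ → ℤ) : cnt i (sing n m) ≤ if i ≤ n then (m i).natAbs else 0 := by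
  induction n with
  | zero =>
    have := cnt_of_zpow i 0 (m 0)
    simp only [sing, zero_add, List.range_one, List.map_cons, List.map_nil, List.prod_cons,
      List.prod_nil, mul_one]
    by_cases h : i = 0
    · subst h; simpa using this
    · have h' : ¬ 0 = i := fun h'' => h h''.symm
      simpa [h, h'] using this
  | succ n ih =>
    rw [sing_succ]
    have h := cnt_mul i (sing n m) (FreeGroup.of (n+1) ^ m (n+1))
    have h2 := cnt_of_zpow i (n+1) (m (n+1))
    by_cases h3 : n + 1 = i
    · subst h3
      simp at ih h2 ⊢
      omega
    · rw [if_neg h3] at h2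
      by_cases h4 : i ≤ n
      · rw [if_pos h4] at ih
        rw [if_pos (by omega)]
        omega
      · rw [if_neg h4] at ih
        rw [if_neg (by omega)]
        omega

theorem ex_sing (i n : ℕ) (m : ℕ → ℤ) : ex i (sing n m) = if i ≤ n then m i else 0 := by
  induction n with
  | zero =>
    simp only [sing, zero_add, List.range_one, List.map_cons, List.map_nil, List.prod_cons,
      List.prod_nil, mul_one, ex_zpow, ex_of]
    by_cases h : i = 0
    · subst h; simp
    · have h' : ¬ 0 = i := fun h'' => h h''.symm
      simp [h, h']
  | succ n ih =>
    rw [sing_succ, ex_mul, ih, ex_zpow, ex_of]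
    by_cases h3 : n + 1 = i
    · subst h3
      simp
    · by_cases h4 : i ≤ n
      · rw [if_pos h4, if_neg h3, if_pos (by omega)]; simp
      · rw [if_neg h4, if_neg h3, if_neg (by omega)]; simp

/-- words differ by at most one initial letter -/
def Adj (a b : F) : Prop :=
  a.toWord = b.toWord ∨ (∃ p, b.toWord = p :: a.toWord) ∨ (∃ p, a.toWord = p :: b.toWord)

theorem Adj.symm {a b : F} (h : Adj a b) : Adj b a := by
  rcases h with h | h | h
  · exact Or.inl h.symm
  · exact Or.inr (Or.inr h)
  · exact Or.inr (Or.inl h)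

theorem adj_letter (p : ℕ × Bool) (a : F) : Adj a (FreeGroup.mk [p] * a) := by
  have : (FreeGroup.mk [p] * a).toWord = FreeGroup.reduce (p :: a.toWord) := by
    conv_lhs => rw [← FreeGroup.mk_toWord (x := a), FreeGroup.mul_mk, FreeGroup.toWord_mk]
    rfl
  rw [FreeGroup.reduce.cons, FreeGroup.reduce_toWord] at this
  rw [Adj, this]
  rcases a.toWord with _ | ⟨hd, tl⟩
  · right; left; exact ⟨p, rfl⟩
  · by_cases h : p.1 = hd.1 ∧ p.2 = !hd.2
    · right; right
      refine ⟨hd, ?_⟩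
      simp [h]
    · right; left
      refine ⟨p, ?_⟩
      simp only [if_neg h]

theorem adj_zpow (i : ℕ) {c : ℤ} (hc : |c| ≤ 1) (a : F) : Adj a (FreeGroup.of i ^ c * a) := by
  rw [abs_le] at hc
  obtain h | h | h : c = -1 ∨ c = 0 ∨ c = 1 := by omega
  · subst h
    rw [zpow_neg_one]
    exact adj_letter (i, false) a
  · subst h; left; simp
  · subst h
    rw [zpow_one]
    exact adj_letter (i, true) a

theorem suffix_adj {w : List (ℕ × Bool)} {a b : F} (h : Adj a b) (hb : w.length ≤ b.toWord.length)
    (ha : w <:+ a.toWord) : w <:+ b.toWord := by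
  rcases h with h | ⟨p, h⟩ | ⟨p, h⟩
  · rwa [← h]
  · rw [h]; exact ha.trans (List.suffix_cons _ _)
  · rw [h, List.suffix_cons_iff] at ha
    rcases ha with ha | ha
    · rw [ha] at hb; simp at hb
    · exact ha

theorem exists_min {G : I → F} (hG : ∀ s, ∀ᶠ t in 𝓝 s, Adj (G s) (G t)) {s t : I} (hst : s ≤ t) :
    ∃ r, s ≤ r ∧ r ≤ t ∧ (∀ j, cnt j (G r) ≤ cnt j (G s)) ∧ (∀ j, cnt j (G r) ≤ cnt j (G t)) ∧
      ∀ i, |ex i (G s) - ex i (G t)| ≤ (cnt i (G s) : ℤ) + cnt i (G t) - 2 * cnt i (G r) := by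
  have hne : Nonempty (Icc s t) := ⟨⟨s, le_rfl, hst⟩⟩
  obtain ⟨r, hmin⟩ : ∃ r : Icc s t, ∀ y : Icc s t,
      (G r).toWord.length ≤ (G y).toWord.length :=
    ⟨Function.argmin (fun y : Icc s t => (G y).toWord.length),
      fun y => Function.argmin_le (fun y : Icc s t => (G y).toWord.length) y⟩
  have hpc : PreconnectedSpace (Icc s t) := Subtype.preconnectedSpace isPreconnected_Icc
  have hsuf : ∀ y : Icc s t, (G r).toWord <:+ (G y).toWord := by
    intro y
    refine pred_const (P := fun y : Icc s t => (G r).toWord <:+ (G y).toWord) ?_ (a := r)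
      List.suffix_rfl y
    intro y
    filter_upwards [continuous_subtype_val.continuousAt.eventually (hG y)] with z hz
    exact ⟨fun h => suffix_adj hz.symm (hmin y) h, fun h => suffix_adj hz (hmin z) h⟩
  obtain ⟨L, hL⟩ := hsuf ⟨s, le_rfl, hst⟩
  obtain ⟨L', hL'⟩ := hsuf ⟨t, hst, le_rfl⟩
  simp only at hL hL'
  have hc : ∀ i, cnt i (G s) = wc i L + cnt i (G r) := fun i => by
    rw [cnt, ← hL, wc_append, cnt]
  have hc' : ∀ i, cnt i (G t) = wc i L' + cnt i (G r) := fun i => by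
    rw [cnt, ← hL', wc_append, cnt]
  have hm : G s = FreeGroup.mk L * G r := by
    rw [← FreeGroup.mk_toWord (x := G s), ← hL, ← FreeGroup.mul_mk, FreeGroup.mk_toWord]
  have hm' : G t = FreeGroup.mk L' * G r := by
    rw [← FreeGroup.mk_toWord (x := G t), ← hL', ← FreeGroup.mul_mk, FreeGroup.mk_toWord]
  refine ⟨r, r.2.1, r.2.2, fun j => by rw [hc]; omega, fun j => by rw [hc']; omega, fun i => ?_⟩
  have e : ex i (G s) - ex i (G t) = ex i (FreeGroup.mk L) - ex i (FreeGroup.mk L') := by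
    rw [hm, hm', ex_mul, ex_mul]; ring
  rw [e, hc, hc']
  have h1 := ex_mk_le i L
  have h2 := ex_mk_le i L'
  rw [abs_le] at *
  push_cast
  constructor <;> omega

end HE

namespace HE

open Set Filter Topology unitInterval

theorem round_diff (a b : ℝ) : |((round a - round b : ℤ) : ℝ)| ≤ |a - b| + 1 := by
  have h1 := abs_le.1 (abs_sub_round a)
  have h2 := abs_le.1 (abs_sub_round b)
  have h3 := abs_le.1 (le_refl |a - b|)
  push_cast
  rw [abs_le]
  constructor <;> linarith [h1.1, h1.2, h2.1, h2.2, h3.1, h3.2]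

theorem norm_eq_rep {z : UnitAddCircle} (h : ‖z‖ < 1/4) : |rep z| = ‖z‖ := by
  have h1 := norm_sub_eq z 0
  rw [sub_zero, crs_zero_right (by rwa [sub_zero]), rep_zero] at h1
  rw [h1]; simp

/-- power map -/
noncomputable def pw (M : ℕ) : F →* F := FreeGroup.lift (fun j => FreeGroup.of j ^ M)

theorem pw_of_zpow (M i : ℕ) (c : ℤ) : pw M (FreeGroup.of i ^ c) = FreeGroup.of i ^ (M * c : ℤ) := by
  rw [map_zpow, pw, FreeGroup.lift_apply_of, zpow_mul, zpow_natCast]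

theorem cnt_pw (i M : ℕ) (a : F) : cnt i (pw M a) ≤ M * cnt i a := by
  refine cnt_map i _ M (fun j => ?_) a
  have h := cnt_of_zpow i j M
  rw [pw, FreeGroup.lift_apply_of]
  simpa using h

theorem ex_pw (i M : ℕ) (a : F) : ex i (pw M a) = M * ex i a := by
  induction a using FreeGroup.induction_on with
  | C1 => simp [ex_one]
  | of j =>
    have := ex_zpow i (FreeGroup.of j) M
    rw [zpow_natCast] at this
    rw [pw, FreeGroup.lift_apply_of, this]
  | inv_of j h => rw [map_inv, ex_inv, ex_inv, h]; ring
  | mul a b ha hb => rw [map_mul, ex_mul, ha, hb, ex_mul]; ring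

section Data

variable {X : Type*} [TopologicalSpace X] (D : Earring X)

noncomputable def Earring.κ (n : ℕ) (x : X) : F :=
  sing n (fun i => round (((n + 1 : ℕ) : ℝ) * rep (D.q i x)))

noncomputable def Earring.G (n : ℕ) (α : C(I, X)) (s : I) : F :=
  D.κ n (α s) * pw (n + 1) (D.g n α s)

/-- the exponent of a step along circle `i` -/
noncomputable def Earring.e (n i : ℕ) (x y : X) : ℤ :=
  round (((n + 1 : ℕ) : ℝ) * (rep (D.q i y) + crs (D.q i x) (D.q i y))) -
    round (((n + 1 : ℕ) : ℝ) * rep (D.q i x))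

theorem Earring.e_le (n i : ℕ) (x y : X) :
    |(D.e n i x y : ℝ)| ≤ ((n + 1 : ℕ) : ℝ) * ‖D.q i x - D.q i y‖ + 1 := by
  refine (round_diff _ _).trans ?_
  rw [← mul_sub, abs_mul, norm_sub_eq, abs_of_nonneg (Nat.cast_nonneg _)]

theorem Earring.same_circle {n i : ℕ} (hi : i ≤ n) {x y : X}
    (h : ∀ j ≤ n, j ≠ i → D.q j x = 0 ∧ D.q j y = 0) :
    D.κ n y * pw (n + 1) (D.τ n x y) = FreeGroup.of i ^ D.e n i x y * D.κ n x := by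
  rw [Earring.κ, Earring.κ, Earring.τ,
    sing_single hi (fun j hj hji => by rw [(h j hj hji).2, rep_zero]; simp),
    sing_single hi (fun j hj hji => by rw [(h j hj hji).1, (h j hj hji).2, crs_self]),
    sing_single hi (fun j hj hji => by rw [(h j hj hji).1, rep_zero]; simp),
    pw_of_zpow, ← zpow_add, ← zpow_add]
  congr 1
  rw [Earring.e, mul_add]
  have := round_add_intCast (((n + 1 : ℕ) : ℝ) * rep (D.q i y)) (((n + 1 : ℕ) : ℤ) * crs (D.q i x) (D.q i y))
  push_cast at this ⊢
  rw [this]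
  ring

theorem Earring.eventually_same (n : ℕ) (α : C(I, X)) (s : I) :
    ∀ᶠ t in 𝓝 s, ∃ i ≤ n, ∀ j ≤ n, j ≠ i → D.q j (α s) = 0 ∧ D.q j (α t) = 0 := by
  by_cases h : ∃ i ≤ n, D.q i (α s) ≠ 0
  · obtain ⟨i, hi, hs⟩ := h
    have hc : Continuous fun t => D.q i (α t) := by fun_prop
    filter_upwards [hc.continuousAt.eventually_ne hs] with t ht
    exact ⟨i, hi, fun j _ hji => ⟨D.disj _ i j hji.symm hs, D.disj _ i j hji.symm ht⟩⟩
  · push Not at h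
    refine Eventually.of_forall fun t => ?_
    by_cases h' : ∃ i ≤ n, D.q i (α t) ≠ 0
    · obtain ⟨i, hi, ht⟩ := h'
      exact ⟨i, hi, fun j hj hji => ⟨h j hj, D.disj _ i j hji.symm ht⟩⟩
    · push Not at h'
      exact ⟨0, Nat.zero_le _, fun j hj _ => ⟨h j hj, h' j hj⟩⟩

theorem Earring.eventually_norm (i : ℕ) (α : C(I, X)) (s : I) {ε : ℝ} (hε : 0 < ε) :
    ∀ᶠ t in 𝓝 s, ‖D.q i (α s) - D.q i (α t)‖ < ε := by
  have hc : Continuous fun t => ‖D.q i (α s) - D.q i (α t)‖ := by fun_prop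
  exact hc.continuousAt.eventually_lt continuousAt_const (by simpa using hε)

theorem Earring.G_adj (n : ℕ) (α : C(I, X)) (s : I) :
    ∀ᶠ t in 𝓝 s, Adj (D.G n α s) (D.G n α t) := by
  have hM : (0 : ℝ) < ((n + 1 : ℕ) : ℝ) := by positivity
  have h2 : ∀ᶠ t in 𝓝 s, ∀ i ∈ Iic n, ‖D.q i (α s) - D.q i (α t)‖ < 1 / ((n + 1 : ℕ) : ℝ) :=
    (eventually_all_finite (finite_Iic n)).2 fun i _ => D.eventually_norm i α s (by positivity)
  filter_upwards [D.eventually_same n α s, h2, D.g_lift n α s] with t ⟨i, hi, hs⟩ h2 h3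
  rw [Earring.G, Earring.G, h3, map_mul, ← mul_assoc, D.same_circle hi hs, mul_assoc]
  refine adj_zpow i ?_ _
  have h4 := D.e_le n i (α s) (α t)
  have h5 := h2 i hi
  rw [lt_div_iff₀ hM] at h5
  have h6 : |(D.e n i (α s) (α t) : ℝ)| < 2 := by linarith
  have h7 : |D.e n i (α s) (α t)| < 2 := by exact_mod_cast h6
  omega

/-- on a connected set where the path stays close, the lift is given by the cocycle -/
theorem Earring.g_local {n : ℕ} {α : C(I, X)} {V : Set I} (hV : IsPreconnected V) {s : I}
    (hs : s ∈ V) (hR : ∀ t ∈ V, D.R n (α s) (α t)) {t : I} (ht : t ∈ V) :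
    D.g n α t = D.τ n (α s) (α t) * D.g n α s := by
  have : PreconnectedSpace V := Subtype.preconnectedSpace hV
  refine pred_const (P := fun t : V => D.g n α t = D.τ n (α s) (α t) * D.g n α s) ?_ (a := ⟨s, hs⟩)
    (by simp [(D.cocycle n).self]) ⟨t, ht⟩
  intro t
  filter_upwards [continuous_subtype_val.continuousAt.eventually (D.g_lift n α t),
    continuous_subtype_val.continuousAt.eventually (D.eventually_R n α t)] with t' h1 h2
  rw [h1, ← (D.cocycle n).coc (α s) (α t) (α t') (hR t t.2) h2 (hR t' t'.2), mul_assoc,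
    mul_right_inj]

theorem Earring.g_avoid {n i : ℕ} {α : C(I, X)} {V : Set I} (hV : IsPreconnected V) {s : I}
    (hs : s ∈ V) (hR : ∀ t ∈ V, ‖D.q i (α t)‖ < 1/4) {t : I} (ht : t ∈ V) :
    cnt i (D.g n α t * (D.g n α s)⁻¹) = 0 := by
  have : PreconnectedSpace V := Subtype.preconnectedSpace hV
  refine pred_const (P := fun t : V => cnt i (D.g n α t * (D.g n α s)⁻¹) = 0) ?_ (a := ⟨s, hs⟩)
    (by simp [cnt_one]) ⟨t, ht⟩
  intro t
  filter_upwards [continuous_subtype_val.continuousAt.eventually (D.g_lift n α t)] with t' h1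
  have h0 : cnt i (D.τ n (α t) (α t')) = 0 := by
    have h := cnt_sing i n (fun i => crs (D.q i (α t)) (D.q i (α t')))
    have h2 : crs (D.q i (α t)) (D.q i (α t')) = 0 := by
      have a1 := hR t t.2
      have a2 := hR t' t'.2
      have b1 := norm_eq_rep a1
      have b2 := norm_eq_rep a2
      rw [← b1, abs_lt] at a1
      rw [← b2, abs_lt] at a2
      rw [crs, round_eq_zero_iff]
      constructor <;> linarith [a1.1, a1.2, a2.1, a2.2]
    simp only [h2] at h
    simpa [Earring.τ] using h
  have key : ∀ a b c : F, cnt i c = 0 → b = c * a → cnt i a = 0 → cnt i b = 0 := by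
    rintro a b c hc rfl ha
    have := cnt_mul i c a
    omega
  constructor
  · refine key _ _ (D.τ n (α t) (α t'))⁻¹ (by rw [cnt_inv, h0]) ?_
    rw [h1]; group
  · refine key _ _ (D.τ n (α t) (α t')) h0 ?_
    rw [h1]; group

theorem exists_conn {s : I} {p : I → Prop} (h : ∀ᶠ t in 𝓝 s, p t) :
    ∃ V ∈ 𝓝 s, IsPreconnected V ∧ ∀ t ∈ V, p t := by
  obtain ⟨ε, hε, hsub⟩ := Metric.mem_nhds_iff.1 h
  refine ⟨Metric.ball s ε, Metric.ball_mem_nhds s hε, ?_, fun t ht => hsub ht⟩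
  have : Metric.ball s ε = (Subtype.val : I → ℝ) ⁻¹' Ioo ((s : ℝ) - ε) (s + ε) := by
    rw [← Real.ball_eq_Ioo]; rfl
  rw [this]
  exact (ordConnected_Ioo.preimage_mono (Subtype.mono_coe _)).isPreconnected

theorem Earring.equi (i : ℕ) (α : C(I, X)) (s : I) {ε : ℝ} (hε : 0 < ε) :
    ∀ᶠ t in 𝓝 s, ∀ n ≥ i, (cnt i (D.G n α t * (D.G n α s)⁻¹) : ℝ) ≤ ((n + 1 : ℕ) : ℝ) * ε + 1 := by
  by_cases h : D.q i (α s) = 0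
  · obtain ⟨V, hV, hVc, hVp⟩ := exists_conn ((D.eventually_norm i α s hε).and
      (D.eventually_norm i α s (ε := 1/4) (by norm_num)))
    simp only [h, zero_sub, norm_neg] at hVp
    filter_upwards [hV] with t ht n hn
    have h1 := D.g_avoid (n := n) hVc (mem_of_mem_nhds hV) (fun t ht => (hVp t ht).2) ht
    have h2 : D.G n α t * (D.G n α s)⁻¹ =
        D.κ n (α t) * (pw (n + 1) (D.g n α t * (D.g n α s)⁻¹) * (D.κ n (α s))⁻¹) := by
      simp only [Earring.G, map_mul, map_inv]; group
    have h3 : cnt i (D.G n α t * (D.G n α s)⁻¹) ≤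
        cnt i (D.κ n (α t)) + cnt i (D.κ n (α s)) := by
      rw [h2]
      have a1 := cnt_mul i (D.κ n (α t)) (pw (n + 1) (D.g n α t * (D.g n α s)⁻¹) * (D.κ n (α s))⁻¹)
      have a2 := cnt_mul i (pw (n + 1) (D.g n α t * (D.g n α s)⁻¹)) (D.κ n (α s))⁻¹
      have a3 := cnt_pw i (n+1) (D.g n α t * (D.g n α s)⁻¹)
      rw [h1] at a3
      rw [cnt_inv] at a2
      omega
    have h4 := cnt_sing i n (fun i => round (((n + 1 : ℕ) : ℝ) * rep (D.q i (α s))))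
    rw [if_pos hn, h, rep_zero, mul_zero, round_zero] at h4
    have h5 := cnt_sing i n (fun i => round (((n + 1 : ℕ) : ℝ) * rep (D.q i (α t))))
    rw [if_pos hn] at h5
    have h6 : cnt i (D.G n α t * (D.G n α s)⁻¹) ≤
        (round (((n + 1 : ℕ) : ℝ) * rep (D.q i (α t)))).natAbs := by
      rw [Earring.κ, Earring.κ] at h3
      simp only [Int.natAbs_zero] at h4
      omega
    have h7 := round_diff (((n + 1 : ℕ) : ℝ) * rep (D.q i (α t))) 0
    rw [round_zero, sub_zero, sub_zero, abs_mul, norm_eq_rep (hVp t ht).2, Nat.abs_cast] at h7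
    have h8 : (cnt i (D.G n α t * (D.G n α s)⁻¹) : ℝ) ≤
        |((round (((n + 1 : ℕ) : ℝ) * rep (D.q i (α t))) : ℤ) : ℝ)| := by
      rw [← Int.cast_abs, Int.abs_eq_natAbs]
      exact_mod_cast h6
    refine h8.trans (h7.trans ?_)
    have := mul_le_mul_of_nonneg_left (hVp t ht).1.le (Nat.cast_nonneg (α := ℝ) (n + 1))
    linarith
  · have hc : Continuous fun t => D.q i (α t) := by fun_prop
    obtain ⟨V, hV, hVc, hVp⟩ := exists_conn ((hc.continuousAt.eventually_ne h).and
      ((D.eventually_norm i α s hε).and (D.eventually_norm i α s (ε := 1/4) (by norm_num))))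
    filter_upwards [hV] with t ht n hn
    have hz : ∀ t ∈ V, ∀ j ≤ n, j ≠ i → D.q j (α s) = 0 ∧ D.q j (α t) = 0 := fun t ht j _ hji =>
      ⟨D.disj _ i j hji.symm h, D.disj _ i j hji.symm (hVp t ht).1⟩
    have h1 := D.g_local (n := n) hVc (mem_of_mem_nhds hV) (fun t ht j hj => by
      by_cases hji : j = i
      · subst hji; exact (hVp t ht).2.2
      · rw [(hz t ht j hj hji).1, (hz t ht j hj hji).2]; simp) ht
    have h2 : D.G n α t * (D.G n α s)⁻¹ = FreeGroup.of i ^ D.e n i (α s) (α t) := by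
      rw [Earring.G, Earring.G, h1, map_mul, ← mul_assoc, D.same_circle hn (hz t ht)]
      group
    have h3 := cnt_of_zpow i i (D.e n i (α s) (α t))
    rw [if_pos rfl, ← h2] at h3
    have h4 : (cnt i (D.G n α t * (D.G n α s)⁻¹) : ℝ) ≤ |(D.e n i (α s) (α t) : ℝ)| := by
      rw [← Int.cast_abs, Int.abs_eq_natAbs]
      exact_mod_cast h3
    refine h4.trans ((D.e_le _ _ _ _).trans ?_)
    have := mul_le_mul_of_nonneg_left (hVp t ht).2.1.le (Nat.cast_nonneg (α := ℝ) (n + 1))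
    linarith

/-- normalized letter count -/
noncomputable def Earring.a (i : ℕ) (α : C(I, X)) (n : ℕ) (s : I) : ℝ :=
  cnt i (D.G n α s) / ((n + 1 : ℕ) : ℝ)

theorem Earring.a_equi (i : ℕ) (α : C(I, X)) (s : I) {ε : ℝ} (hε : 0 < ε) :
    ∀ᶠ t in 𝓝 s, ∀ n ≥ i, |D.a i α n t - D.a i α n s| ≤ ε + 1 / ((n + 1 : ℕ) : ℝ) := by
  filter_upwards [D.equi i α s hε] with t ht n hn
  have hM : (0 : ℝ) < ((n + 1 : ℕ) : ℝ) := by positivity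
  have h1 := ht n hn
  have h2 : cnt i (D.G n α t) ≤ cnt i (D.G n α t * (D.G n α s)⁻¹) + cnt i (D.G n α s) := by
    have := cnt_mul i (D.G n α t * (D.G n α s)⁻¹) (D.G n α s)
    rwa [inv_mul_cancel_right] at this
  have h3 : cnt i (D.G n α s) ≤ cnt i (D.G n α t * (D.G n α s)⁻¹) + cnt i (D.G n α t) := by
    have := cnt_mul i (D.G n α t * (D.G n α s)⁻¹)⁻¹ (D.G n α t)
    rw [cnt_inv] at this
    simpa using this
  have h2' : (cnt i (D.G n α t) : ℝ) ≤ cnt i (D.G n α t * (D.G n α s)⁻¹) + cnt i (D.G n α s) := by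
    exact_mod_cast h2
  have h3' : (cnt i (D.G n α s) : ℝ) ≤ cnt i (D.G n α t * (D.G n α s)⁻¹) + cnt i (D.G n α t) := by
    exact_mod_cast h3
  rw [Earring.a, Earring.a, ← sub_div, abs_div, abs_of_pos hM, div_le_iff₀ hM, add_mul,
    one_div_mul_cancel hM.ne', abs_le]
  constructor <;> linarith

end Data
end HE

namespace HE

open Set Filter Topology unitInterval

theorem tendsto_inv_succ : Tendsto (fun n : ℕ => 1 / ((n + 1 : ℕ) : ℝ)) (hyperfilter ℕ : Filter ℕ) (𝓝 0) := by
  have := tendsto_one_div_add_atTop_nhds_zero_nat (𝕜 := ℝ)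
  rw [← Nat.cofinite_eq_atTop] at this
  refine (this.mono_left (hyperfilter_le_cofinite)).congr fun n => ?_
  push_cast; rfl

theorem hyper_ge (i : ℕ) : ∀ᶠ n in (hyperfilter ℕ : Filter ℕ), i ≤ n := by
  have := eventually_ge_atTop i
  rw [← Nat.cofinite_eq_atTop] at this
  exact hyperfilter_le_cofinite this

section Data

variable {X : Type*} [TopologicalSpace X] (D : Earring X) {x : X}

theorem Earring.G_base {n : ℕ} {α : C(I, X)} {s : I} (hx : ∀ i, D.q i (α s) = 0)
    (hg : D.g n α s = 1) : D.G n α s = 1 := by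
  rw [Earring.G, hg, map_one, mul_one, Earring.κ, sing_one]
  intro j _
  rw [hx, rep_zero, mul_zero, round_zero]

theorem Earring.a_nonneg (i : ℕ) (α : C(I, X)) (n : ℕ) (s : I) : 0 ≤ D.a i α n s := by
  rw [Earring.a]; positivity

theorem Earring.a_bound (i : ℕ) {α : C(I, X)} (hx : ∀ i, D.q i (α 0) = 0) (s : I) :
    ∃ C, ∀ n ≥ i, D.a i α n s ≤ C := by
  refine pred_const (P := fun s => ∃ C, ∀ n ≥ i, D.a i α n s ≤ C) ?_ (a := 0)
    ⟨0, fun n _ => ?_⟩ s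
  · intro s
    filter_upwards [D.a_equi i α s one_pos] with t ht
    have hM : ∀ n : ℕ, 1 / ((n + 1 : ℕ) : ℝ) ≤ 1 := fun n => by
      rw [div_le_one (by positivity)]; push_cast; linarith [Nat.cast_nonneg (α := ℝ) n]
    constructor
    · rintro ⟨C, hC⟩
      refine ⟨C + 2, fun n hn => ?_⟩
      have := abs_le.1 (ht n hn)
      linarith [hC n hn, hM n, this.1]
    · rintro ⟨C, hC⟩
      refine ⟨C + 2, fun n hn => ?_⟩
      have := abs_le.1 (ht n hn)
      linarith [hC n hn, hM n, this.2]
  · rw [Earring.a, D.G_base hx (D.g_zero _ _), cnt_one]; simp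

theorem Earring.exists_lim (i : ℕ) {α : C(I, X)} (hx : ∀ i, D.q i (α 0) = 0) (s : I) :
    ∃ L, Tendsto (fun n => D.a i α n s) (hyperfilter ℕ : Filter ℕ) (𝓝 L) := by
  obtain ⟨C, hC⟩ := D.a_bound i hx s
  have hmem : ∀ᶠ n in (hyperfilter ℕ : Filter ℕ), D.a i α n s ∈ Icc 0 C := by
    filter_upwards [hyper_ge i] with n hn
    exact ⟨D.a_nonneg _ _ _ _, hC n hn⟩
  obtain ⟨L, -, hL⟩ := isCompact_Icc.ultrafilter_le_nhds ((hyperfilter ℕ).map (fun n => D.a i α n s))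
    (by rw [le_principal_iff]; exact hmem)
  exact ⟨L, hL⟩

theorem Earring.ex_G (i : ℕ) (α : C(I, X)) {n : ℕ} (hn : i ≤ n) (s : I) :
    ex i (D.G n α s) = round (((n + 1 : ℕ) : ℝ) * rep (D.q i (α s))) + ((n + 1 : ℕ) : ℤ) * ex i (D.g i α s) := by
  rw [Earring.G, ex_mul, ex_pw, Earring.κ, ex_sing, if_pos hn, ← D.kill_g hn, ex_kill le_rfl]

theorem Earring.ex_lim (i : ℕ) (α : C(I, X)) (s : I) :
    Tendsto (fun n => (ex i (D.G n α s) : ℝ) / ((n + 1 : ℕ) : ℝ)) (hyperfilter ℕ : Filter ℕ)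
      (𝓝 (rep (D.q i (α s)) + ex i (D.g i α s))) := by
  rw [tendsto_iff_norm_sub_tendsto_zero]
  refine squeeze_zero' (Eventually.of_forall fun n => norm_nonneg _) ?_ tendsto_inv_succ
  filter_upwards [hyper_ge i] with n hn
  have hM : (0 : ℝ) < ((n + 1 : ℕ) : ℝ) := by positivity
  rw [D.ex_G i α hn, Real.norm_eq_abs]
  have h := abs_sub_round (((n + 1 : ℕ) : ℝ) * rep (D.q i (α s)))
  have e : ((round (((n + 1 : ℕ) : ℝ) * rep (D.q i (α s))) + ((n + 1 : ℕ) : ℤ) * ex i (D.g i α s) : ℤ) : ℝ) /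
      ((n + 1 : ℕ) : ℝ) - (rep (D.q i (α s)) + ex i (D.g i α s)) =
      -(((n + 1 : ℕ) : ℝ) * rep (D.q i (α s)) - round (((n + 1 : ℕ) : ℝ) * rep (D.q i (α s)))) / ((n + 1 : ℕ) : ℝ) := by
    field_simp
    push_cast
    ring
  rw [e, abs_div, abs_neg, abs_of_pos hM]
  gcongr
  linarith

theorem Earring.main {α : Path x x} (hx : ∀ i, D.q i x = 0)
    (h1 : ∀ n, D.H x n (pathClass α) = 1) : α.Homotopic (Path.refl x) := by
  set β : C(I, X) := α.toContinuousMap with hβ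
  have hβ0 : ∀ i, D.q i (β 0) = 0 := fun i => by
    have : β 0 = x := α.source
    rw [this, hx]
  have hβ1 : ∀ i, D.q i (β 1) = 0 := fun i => by
    have : β 1 = x := α.target
    rw [this, hx]
  choose f hf using fun i s => D.exists_lim i hβ0 s
  have hfpos : ∀ i s, 0 ≤ f i s := fun i s =>
    ge_of_tendsto (hf i s) (Eventually.of_forall fun n => D.a_nonneg _ _ _ _)
  have hG0 : ∀ n, D.G n β 0 = 1 := fun n => D.G_base hβ0 (D.g_zero _ _)
  have hG1 : ∀ n, D.G n β 1 = 1 := fun n => D.G_base hβ1 (h1 n)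
  have hf0 : ∀ i, f i 0 = 0 := fun i => by
    refine tendsto_nhds_unique (hf i 0) (tendsto_const_nhds.congr fun n => ?_)
    rw [Earring.a, hG0, cnt_one]; simp
  have hf1 : ∀ i, f i 1 = 0 := fun i => by
    refine tendsto_nhds_unique (hf i 1) (tendsto_const_nhds.congr fun n => ?_)
    rw [Earring.a, hG1, cnt_one]; simp
  have hfc : ∀ i, Continuous (f i) := by
    intro i
    rw [continuous_iff_continuousAt]
    intro s
    rw [ContinuousAt, Metric.tendsto_nhds]
    intro ε hε
    filter_upwards [D.a_equi i β s (half_pos hε)] with t ht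
    have : |f i t - f i s| ≤ ε / 2 + 0 := by
      refine le_of_tendsto_of_tendsto ((hf i t).sub (hf i s)).abs
        (tendsto_const_nhds.add tendsto_inv_succ) ?_
      filter_upwards [hyper_ge i] with n hn
      exact ht n hn
    rw [Real.dist_eq]
    linarith
  have hB : ∀ i, ∃ B, ∀ s, f i s ≤ B := fun i => by
    obtain ⟨C, hC⟩ := (isCompact_range (hfc i)).bddAbove
    exact ⟨C, fun s => hC (mem_range_self s)⟩
  choose B hB using hB
  have hBpos : ∀ i, 0 < 1 + B i := fun i => by linarith [hfpos i 0, hB i 0]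
  set w : ℕ → ℝ := fun i => (1/2) ^ i / (1 + B i) with hw
  have hwpos : ∀ i, 0 < w i := fun i => by
    have := hBpos i
    positivity
  have hwf : ∀ i s, w i * f i s ≤ (1/2) ^ i := fun i s => by
    rw [hw]
    simp only
    rw [div_mul_eq_mul_div, div_le_iff₀ (hBpos i)]
    refine mul_le_mul_of_nonneg_left ?_ (by positivity)
    linarith [hB i s]
  have hsum : ∀ s, Summable fun i => w i * f i s := fun s =>
    Summable.of_nonneg_of_le (fun i => mul_nonneg (hwpos i).le (hfpos i s)) (fun i => hwf i s)
      summable_geometric_two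
  refine contour_null α (f := fun s => ∑' i, w i * f i s) ?_ ?_ ?_ ?_ ?_
  · refine continuous_tsum (fun i => continuous_const.mul (hfc i)) summable_geometric_two ?_
    intro i s
    rw [Real.norm_of_nonneg (mul_nonneg (hwpos i).le (hfpos i s))]
    exact hwf i s
  · exact fun s => tsum_nonneg fun i => mul_nonneg (hwpos i).le (hfpos i s)
  · simp [hf0]
  · simp [hf1]
  · intro s t hst hfst hmin
    choose r hr1 hr2 hr3 hr4 hr5 using fun n => exists_min (D.G_adj n β) hst
    obtain ⟨r0, -, hr0⟩ := isCompact_univ.ultrafilter_le_nhds ((hyperfilter ℕ).map r) (by simp)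
    have hr0' : Tendsto r (hyperfilter ℕ : Filter ℕ) (𝓝 r0) := hr0
    have hs0 : s ≤ r0 := ge_of_tendsto hr0' (Eventually.of_forall hr1)
    have ht0 : r0 ≤ t := le_of_tendsto hr0' (Eventually.of_forall hr2)
    have hlim : ∀ i, Tendsto (fun n => D.a i β n (r n)) (hyperfilter ℕ : Filter ℕ) (𝓝 (f i r0)) := by
      intro i
      have : Tendsto (fun n => D.a i β n (r n) - D.a i β n r0) (hyperfilter ℕ : Filter ℕ) (𝓝 0) := by
        rw [Metric.tendsto_nhds]
        intro ε hε
        have h3 := tendsto_inv_succ.eventually_lt (tendsto_const_nhds (x := ε / 2)) (half_pos hε)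
        filter_upwards [hr0'.eventually (D.a_equi i β r0 (half_pos hε)), hyper_ge i, h3] with n a1 a2 a3
        have := a1 n a2
        rw [Real.dist_eq, sub_zero]
        linarith
      have h4 := this.add (hf i r0)
      simpa using h4
    have hle : ∀ y : I, (∀ n j, cnt j (D.G n β (r n)) ≤ cnt j (D.G n β y)) → ∀ i, f i r0 ≤ f i y := by
      intro y hy i
      refine le_of_tendsto_of_tendsto (hlim i) (hf i y) (Eventually.of_forall fun n => ?_)
      simp only [Earring.a]
      gcongr
      exact hy n i
    have heq : ∀ y : I, (∀ i, f i r0 ≤ f i y) → ∑' i, w i * f i y ≤ ∑' i, w i * f i r0 →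
        ∀ i, f i r0 = f i y := by
      intro y hy hle i
      by_contra hne
      have hlt : f i r0 < f i y := lt_of_le_of_ne (hy i) hne
      have := Summable.tsum_lt_tsum (i := i)
        (fun j => mul_le_mul_of_nonneg_left (hy j) (hwpos j).le)
        (mul_lt_mul_of_pos_left hlt (hwpos i)) (hsum r0) (hsum y)
      exact absurd hle (not_le.2 this)
    have hms := hmin r0 hs0 ht0
    have es := heq s (hle s hr3) hms
    have et := heq t (hle t hr4) (hfst ▸ hms)
    refine D.inj _ _ fun i => ?_
    have hz : |(rep (D.q i (β s)) + ex i (D.g i β s)) - (rep (D.q i (β t)) + ex i (D.g i β t))| ≤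
        f i s + f i t - 2 * f i r0 := by
      refine le_of_tendsto_of_tendsto ((D.ex_lim i β s).sub (D.ex_lim i β t)).abs
        (((hf i s).add (hf i t)).sub ((hlim i).const_mul 2)) (Eventually.of_forall fun n => ?_)
      have hM : (0 : ℝ) < ((n + 1 : ℕ) : ℝ) := by positivity
      have h5 : |(ex i (D.G n β s) : ℝ) - ex i (D.G n β t)| ≤
          (cnt i (D.G n β s) : ℝ) + cnt i (D.G n β t) - 2 * cnt i (D.G n β (r n)) := by
        exact_mod_cast hr5 n i
      simp only [Earring.a]
      rw [← sub_div, abs_div, abs_of_pos hM, ← add_div, ← mul_div_assoc, ← sub_div]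
      gcongr
    have hz' : (rep (D.q i (β s)) + ex i (D.g i β s)) - (rep (D.q i (β t)) + ex i (D.g i β t)) = 0 := by
      rw [← abs_eq_zero]
      refine le_antisymm ?_ (abs_nonneg _)
      have := es i
      have := et i
      linarith
    have hz2 : rep (D.q i (β s)) = rep (D.q i (β t)) + ((ex i (D.g i β t) - ex i (D.g i β s) : ℤ) : ℝ) := by
      push_cast
      linarith
    change D.q i (β s) = D.q i (β t)
    rw [← rep_coe (D.q i (β s)), hz2, AddCircle.coe_add, rep_coe]
    have : ((((ex i (D.g i β t) - ex i (D.g i β s) : ℤ) : ℝ)) : UnitAddCircle) = 0 := by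
      rw [AddCircle.coe_eq_zero_iff]
      exact ⟨ex i (D.g i β t) - ex i (D.g i β s), by simp⟩
    rw [this, add_zero]

end Data
end HE

namespace HE

open Set Filter Topology unitInterval

section Data
variable {X : Type*} [TopologicalSpace X] (D : Earring X) {x : X}

theorem Earring.H_loop (i : ℕ) (γ : Path x x) (hi : ∀ t : I, D.q i (γ t) = ((t : ℝ) : UnitAddCircle))
    (hj : ∀ j, j ≠ i → ∀ t : I, D.q j (γ t) = 0) {n : ℕ} (hn : i ≤ n) :
    D.H x n (pathClass γ) = FreeGroup.of i := by
  rw [D.H_class, D.hol_eq]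
  have hi' : ∀ t : I, D.q i (γ.toContinuousMap t) = ((t : ℝ) : UnitAddCircle) := hi
  have hj' : ∀ j, j ≠ i → ∀ t : I, D.q j (γ.toContinuousMap t) = 0 := hj
  have ha : ∀ t : I, ∃ a : ℤ, (a : ℝ) = t - rep (D.q i (γ.toContinuousMap t)) := by
    intro t
    have : (((t : ℝ) - rep (D.q i (γ.toContinuousMap t)) : ℝ) : UnitAddCircle) = 0 := by
      rw [AddCircle.coe_sub, rep_coe, hi', sub_self]
    rw [AddCircle.coe_eq_zero_iff] at this
    obtain ⟨a, ha⟩ := this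
    exact ⟨a, by simpa using ha⟩
  choose a ha using ha
  have h0 : a 0 = 0 := by
    have := ha 0
    rw [hi'] at this
    simp [rep_zero] at this
    exact this
  have h1 : a 1 = 1 := by
    have := ha 1
    rw [hi'] at this
    have e : (((1 : I) : ℝ) : UnitAddCircle) = 0 := by
      simp
    rw [e, rep_zero] at this
    simp at this
    exact_mod_cast this
  have := pred_const (P := fun t : I => D.g n γ.toContinuousMap t = FreeGroup.of i ^ a t) ?_ (a := 0)
    (by rw [D.g_zero, h0, zpow_zero]) 1
  · rw [this, h1, zpow_one]
  · intro s
    have hd : ∀ᶠ t : I in 𝓝 s, |(s : ℝ) - t| < 1/4 := by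
      have hc : Continuous fun t : I => |(s : ℝ) - t| := by fun_prop
      exact hc.continuousAt.eventually_lt continuousAt_const (by simp)
    filter_upwards [D.g_lift n γ.toContinuousMap s, hd,
      D.eventually_norm i γ.toContinuousMap s (ε := 1/4) (by norm_num)] with t b1 b2 b3
    have hτ : D.τ n (γ.toContinuousMap s) (γ.toContinuousMap t) =
        FreeGroup.of i ^ crs (D.q i (γ.toContinuousMap s)) (D.q i (γ.toContinuousMap t)) :=
      sing_single hn fun j _ hji => by rw [hj' j hji, hj' j hji, crs_self]
    have hat : a t = crs (D.q i (γ.toContinuousMap s)) (D.q i (γ.toContinuousMap t)) + a s := by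
      rw [norm_sub_eq, abs_lt] at b3
      rw [abs_lt] at b2
      have : a t - crs (D.q i (γ.toContinuousMap s)) (D.q i (γ.toContinuousMap t)) - a s = 0 := by
        apply int_eq_zero_of_abs_lt
        push_cast
        rw [ha t, ha s, abs_lt]
        constructor <;> linarith [b3.1, b3.2, b2.1, b2.2]
      omega
    rw [b1, hτ, hat, zpow_add, mul_right_inj]

end Data

/-! ### Geometry -/

theorem mem_circle {k : ℕ} (hk : 1 ≤ k) {p : ℝ × ℝ} :
    p ∈ hawaiianCircle k ↔ (k : ℝ) * (p.1 ^ 2 + p.2 ^ 2) = 2 * p.2 := by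
  have hk' : (0 : ℝ) < k := by exact_mod_cast hk
  change p.1 ^ 2 + (p.2 - 1 / (k : ℝ)) ^ 2 = (1 / (k : ℝ)) ^ 2 ↔ _
  constructor
  · intro h
    field_simp at h
    nlinarith
  · intro h
    field_simp
    nlinarith

theorem exists_circle (p : HawaiianEarring) :
    ∃ i : ℕ, ((i + 1 : ℕ) : ℝ) * (p.1.1 ^ 2 + p.1.2 ^ 2) = 2 * p.1.2 := by
  obtain ⟨k, hk, hp⟩ := mem_iUnion₂.1 p.2
  have hk : 1 ≤ k := hk
  refine ⟨k - 1, ?_⟩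
  rw [Nat.sub_add_cancel hk]
  exact (mem_circle hk).1 hp

/-- membership in the circle with index `i + 1` -/
def onC (i : ℕ) (p : HawaiianEarring) : Prop :=
  ((i + 1 : ℕ) : ℝ) * (p.1.1 ^ 2 + p.1.2 ^ 2) = 2 * p.1.2

theorem eq_base {p : HawaiianEarring} (h : p.1.1 ^ 2 + p.1.2 ^ 2 = 0) : p = hawaiianBasepoint := by
  have h1 : p.1.1 = 0 := by nlinarith [sq_nonneg p.1.1, sq_nonneg p.1.2]
  have h2 : p.1.2 = 0 := by nlinarith [sq_nonneg p.1.1, sq_nonneg p.1.2]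
  exact Subtype.ext (Prod.ext h1 h2)

theorem onC_base (i : ℕ) : onC i hawaiianBasepoint := by simp [onC, hawaiianBasepoint]

theorem onC_disj {i j : ℕ} (hij : i ≠ j) {p : HawaiianEarring} (hi : onC i p) (hj : onC j p) :
    p = hawaiianBasepoint := by
  apply eq_base
  rw [onC] at hi hj
  have : (((i + 1 : ℕ) : ℝ) - ((j + 1 : ℕ) : ℝ)) * (p.1.1 ^ 2 + p.1.2 ^ 2) = 0 := by linarith
  rcases mul_eq_zero.1 this with h | h
  · exfalso
    apply hij
    have : ((i + 1 : ℕ) : ℝ) = ((j + 1 : ℕ) : ℝ) := by linarith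
    have : i + 1 = j + 1 := by exact_mod_cast this
    omega
  · exact h

/-- the complex coordinate -/
noncomputable def wz (i : ℕ) (p : HawaiianEarring) : ℂ :=
  ⟨1 - ((i + 1 : ℕ) : ℝ) * p.1.2, ((i + 1 : ℕ) : ℝ) * p.1.1⟩

open Classical in
/-- the complex coordinate, collapsed off the circle -/
noncomputable def zz (i : ℕ) (p : HawaiianEarring) : ℂ := if onC i p then wz i p else 1

theorem wz_cont (i : ℕ) : Continuous (wz i) := by
  have : wz i = fun p => (((1 - ((i + 1 : ℕ) : ℝ) * p.1.2 : ℝ) : ℂ) + ((((i + 1 : ℕ) : ℝ) * p.1.1 : ℝ) : ℂ) * Complex.I) := by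
    ext p
    apply Complex.ext <;> simp [wz]
  rw [this]
  fun_prop

theorem wz_base (i : ℕ) : wz i hawaiianBasepoint = 1 := by
  apply Complex.ext <;> simp [wz, hawaiianBasepoint]

theorem wz_inj {i : ℕ} {p p' : HawaiianEarring} (h : wz i p = wz i p') : p = p' := by
  have h1 := congrArg Complex.re h
  have h2 := congrArg Complex.im h
  simp only [wz] at h1 h2
  have hk : ((i + 1 : ℕ) : ℝ) ≠ 0 := by positivity
  have a1 : p.1.1 = p'.1.1 := mul_left_cancel₀ hk h2
  have a2 : p.1.2 = p'.1.2 := mul_left_cancel₀ hk (by linarith)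
  exact Subtype.ext (Prod.ext a1 a2)

theorem zz_norm (i : ℕ) (p : HawaiianEarring) : ‖zz i p‖ = 1 := by
  rw [zz]
  split_ifs with h
  · have : Complex.normSq (wz i p) = 1 := by
      rw [onC] at h
      simp only [Complex.normSq_apply, wz]
      linear_combination ((i + 1 : ℕ) : ℝ) * h
    rw [Complex.norm_def, this, Real.sqrt_one]
  · simp

theorem zz_cont (i : ℕ) : Continuous (zz i) := by
  set A : Set HawaiianEarring := {p | onC i p} with hA
  set B : Set HawaiianEarring := {p | p.1.1 ^ 2 + p.1.2 ^ 2 ≤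
    |2 * p.1.2 - ((i + 1 : ℕ) : ℝ) * (p.1.1 ^ 2 + p.1.2 ^ 2)|} with hB
  have hAc : IsClosed A := isClosed_eq (by fun_prop) (by fun_prop)
  have hBc : IsClosed B := isClosed_le (by fun_prop) (by fun_prop)
  have hAB : A ∪ B = univ := by
    rw [eq_univ_iff_forall]
    intro p
    by_cases h : onC i p
    · exact Or.inl h
    · right
      obtain ⟨j, hj⟩ := exists_circle p
      change p.1.1 ^ 2 + p.1.2 ^ 2 ≤ |2 * p.1.2 - ((i + 1 : ℕ) : ℝ) * (p.1.1 ^ 2 + p.1.2 ^ 2)|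
      rw [← hj, ← sub_mul, abs_mul, abs_of_nonneg (by positivity : 0 ≤ p.1.1 ^ 2 + p.1.2 ^ 2)]
      have hij : (j : ℤ) - i ≠ 0 := by
        intro h'
        have : j = i := by omega
        subst this
        exact h hj
      have h1 : (1 : ℤ) ≤ |(j : ℤ) - i| := Int.one_le_abs hij
      have h2 : (1 : ℝ) ≤ |(j : ℝ) - i| := by exact_mod_cast h1
      have e : ((j + 1 : ℕ) : ℝ) - ((i + 1 : ℕ) : ℝ) = j - i := by push_cast; ring
      rw [e]
      have h3 : 0 ≤ p.1.1 ^ 2 + p.1.2 ^ 2 := by positivity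
      nlinarith
  have cA : ContinuousOn (zz i) A := by
    refine (wz_cont i).continuousOn.congr fun p hp => ?_
    rw [zz, if_pos (show onC i p from hp)]
  have cB : ContinuousOn (zz i) B := by
    refine (continuousOn_const (c := (1 : ℂ))).congr fun p hp => ?_
    rw [zz]
    split_ifs with h
    · have : p = hawaiianBasepoint := by
        apply eq_base
        have hp : p.1.1 ^ 2 + p.1.2 ^ 2 ≤
          |2 * p.1.2 - ((i + 1 : ℕ) : ℝ) * (p.1.1 ^ 2 + p.1.2 ^ 2)| := hp
        rw [onC] at h
        rw [h, sub_self, abs_zero] at hp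
        exact le_antisymm hp (by positivity)
      rw [this, wz_base]
    · rfl
  rw [← continuousOn_univ, ← hAB]
  exact cA.union_of_isClosed cB hAc hBc

theorem zz_eq_one {i : ℕ} {p : HawaiianEarring} (h : zz i p ≠ 1) : onC i p ∧ p ≠ hawaiianBasepoint := by
  constructor
  · by_contra h'
    rw [zz, if_neg h'] at h
    exact h rfl
  · rintro rfl
    rw [zz, if_pos (onC_base i), wz_base] at h
    exact h rfl

theorem zz_base (i : ℕ) : zz i hawaiianBasepoint = 1 := by
  rw [zz, if_pos (onC_base i), wz_base]

theorem zz_inj {p p' : HawaiianEarring} (h : ∀ i, zz i p = zz i p') : p = p' := by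
  have key : ∀ p p' : HawaiianEarring, (∀ i, zz i p = zz i p') → p ≠ hawaiianBasepoint → p = p' := by
    intro p p' h hp
    obtain ⟨i, hi⟩ := exists_circle p
    have hi : onC i p := hi
    have h1 := h i
    rw [zz, if_pos hi] at h1
    have h2 : zz i p' ≠ 1 := by
      intro h2
      rw [h2, ← wz_base i] at h1
      exact hp (wz_inj h1)
    rw [zz, if_pos (zz_eq_one h2).1] at h1
    exact wz_inj h1
  by_cases hp : p = hawaiianBasepoint
  · by_cases hp' : p' = hawaiianBasepoint
    · rw [hp, hp']
    · exact (key p' p (fun i => (h i).symm) hp').symm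
  · exact key p p' h hp

/-- the circle-valued coordinate -/
noncomputable def cz (i : ℕ) : C(HawaiianEarring, Circle) where
  toFun p := ⟨zz i p, mem_sphere_zero_iff_norm.2 (zz_norm i p)⟩
  continuous_toFun := (zz_cont i).subtype_mk _

theorem cz_eq {i : ℕ} {p p' : HawaiianEarring} : cz i p = cz i p' ↔ zz i p = zz i p' :=
  Subtype.ext_iff

theorem cz_eq_one {i : ℕ} {p : HawaiianEarring} : cz i p = 1 ↔ zz i p = 1 :=
  Subtype.ext_iff

noncomputable def hom : UnitAddCircle ≃ₜ Circle := AddCircle.homeomorphCircle one_ne_zero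

theorem hom_coe (t : ℝ) : hom (t : UnitAddCircle) = Circle.exp (2 * Real.pi * t) := by
  simp [hom, AddCircle.homeomorphCircle_apply, AddCircle.toCircle_apply_mk]

theorem hom_symm_one : hom.symm 1 = 0 := by
  rw [Homeomorph.symm_apply_eq]
  have := hom_coe 0
  simpa using this.symm

/-- the earring structure on the Hawaiian earring -/
noncomputable def HD : Earring HawaiianEarring where
  q i := ((hom.symm : C(Circle, UnitAddCircle))).comp (cz i)
  disj p i j hij h := by
    have h1 : zz i p ≠ 1 := by
      intro h1
      apply h
      change hom.symm (cz i p) = 0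
      rw [cz_eq_one.2 h1, hom_symm_one]
    have h2 : zz j p = 1 := by
      by_contra h2
      exact (zz_eq_one h1).2 (onC_disj hij (zz_eq_one h1).1 (zz_eq_one h2).1)
    change hom.symm (cz j p) = 0
    rw [cz_eq_one.2 h2, hom_symm_one]
  inj p p' h := zz_inj fun i => cz_eq.1 (hom.symm.injective (h i))

theorem HD_q (i : ℕ) (p : HawaiianEarring) : HD.q i p = hom.symm (cz i p) := rfl

theorem HD_base (i : ℕ) : HD.q i hawaiianBasepoint = 0 := by
  rw [HD_q, cz_eq_one.2 (zz_base i), hom_symm_one]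

/-- points of the circles -/
noncomputable def cpt (i : ℕ) (t : ℝ) : HawaiianEarring :=
  ⟨(Real.sin (2 * Real.pi * t) / ((i + 1 : ℕ) : ℝ), (1 - Real.cos (2 * Real.pi * t)) / ((i + 1 : ℕ) : ℝ)), by
    refine mem_iUnion₂.2 ⟨i + 1, (by simp), (mem_circle (by omega)).2 ?_⟩
    have hk : ((i + 1 : ℕ) : ℝ) ≠ 0 := by positivity
    have := Real.sin_sq_add_cos_sq (2 * Real.pi * t)
    simp only
    field_simp
    linear_combination this⟩

theorem cpt_on (i : ℕ) (t : ℝ) : onC i (cpt i t) := by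
  have hk : ((i + 1 : ℕ) : ℝ) ≠ 0 := by positivity
  have := Real.sin_sq_add_cos_sq (2 * Real.pi * t)
  simp only [onC, cpt]
  field_simp
  linear_combination this

theorem cpt_cont (i : ℕ) : Continuous (cpt i) := by
  refine Continuous.subtype_mk ?_ _
  fun_prop

theorem cpt_zero (i : ℕ) : cpt i 0 = hawaiianBasepoint := by
  apply Subtype.ext
  simp [cpt, hawaiianBasepoint]

theorem cpt_one (i : ℕ) : cpt i 1 = hawaiianBasepoint := by
  apply Subtype.ext
  simp [cpt, hawaiianBasepoint]

noncomputable def lp (i : ℕ) : Path hawaiianBasepoint hawaiianBasepoint where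
  toFun t := cpt i t
  continuous_toFun := (cpt_cont i).comp continuous_subtype_val
  source' := cpt_zero i
  target' := cpt_one i

theorem lp_apply (i : ℕ) (t : I) : lp i t = cpt i t := rfl

theorem HD_cpt (i : ℕ) (t : ℝ) : HD.q i (cpt i t) = (t : UnitAddCircle) := by
  rw [HD_q, Homeomorph.symm_apply_eq, hom_coe]
  apply Subtype.ext
  change zz i (cpt i t) = _
  rw [zz, if_pos (cpt_on i t)]
  have hk : ((i + 1 : ℕ) : ℝ) ≠ 0 := by positivity
  change _ = ((Circle.exp (2 * Real.pi * t) : Circle) : ℂ)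
  rw [Circle.coe_exp, Complex.exp_mul_I, ← Complex.ofReal_cos, ← Complex.ofReal_sin]
  apply Complex.ext
  · simp only [wz, cpt, Complex.add_re, Complex.ofReal_re, Complex.mul_re, Complex.I_re, Complex.I_im, Complex.ofReal_im]
    field_simp
    ring
  · simp only [wz, cpt, Complex.add_im, Complex.ofReal_re, Complex.mul_im, Complex.I_re, Complex.I_im, Complex.ofReal_im]
    field_simp
    ring

theorem HD_other {i j : ℕ} (h : j ≠ i) (t : ℝ) : HD.q j (cpt i t) = 0 := by
  by_cases h0 : cpt i t = hawaiianBasepoint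
  · rw [h0, HD_base]
  · rw [HD_q, cz_eq_one.2, hom_symm_one]
    rw [zz, if_neg]
    intro h1
    exact h0 (onC_disj h h1 (cpt_on i t))

theorem H_lp {i n : ℕ} (h : i ≤ n) : HD.H hawaiianBasepoint n (pathClass (lp i)) = FreeGroup.of i :=
  HD.H_loop i (lp i) (fun t => HD_cpt i t) (fun _ hj t => HD_other hj t) h

theorem lp_ne_one (i : ℕ) : pathClass (lp i) ≠ 1 := by
  intro h
  have := H_lp (le_refl i)
  rw [h, map_one] at this
  exact FreeGroup.of_ne_one i this.symm

theorem lp_small {U : Set HawaiianEarring} (hU : U ∈ 𝓝 hawaiianBasepoint) : ∃ i, ∀ t, lp i t ∈ U := by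
  obtain ⟨ε, hε, hsub⟩ := Metric.mem_nhds_iff.1 hU
  obtain ⟨i, hi⟩ := exists_nat_one_div_lt (half_pos hε)
  refine ⟨i, fun t => hsub ?_⟩
  have hk : (0 : ℝ) < ((i + 1 : ℕ) : ℝ) := by positivity
  have hi' : 2 / ((i + 1 : ℕ) : ℝ) < ε := by
    push_cast
    rw [show (2 : ℝ) / (i + 1) = 2 * (1 / (i + 1)) by ring]
    linarith
  rw [Metric.mem_ball, Subtype.dist_eq, lp_apply]
  change max (dist _ _) (dist _ _) < ε
  simp only [cpt, hawaiianBasepoint, Real.dist_eq, sub_zero, abs_div, abs_of_pos hk]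
  have h1 := abs_le.1 (Real.abs_sin_le_one (2 * Real.pi * t))
  have h2 := abs_le.1 (Real.abs_cos_le_one (2 * Real.pi * t))
  refine max_lt (lt_of_le_of_lt ?_ hi') (lt_of_le_of_lt ?_ hi')
  · gcongr
    rw [abs_le]; constructor <;> linarith [h1.1, h1.2]
  · gcongr
    rw [abs_le]; constructor <;> linarith [h2.1, h2.2]

end HE

namespace HE

open Set Filter Topology unitInterval

theorem conj_mem_inducedImage {E X : Type*} [TopologicalSpace E] [TopologicalSpace X]
    {p : E → X} (hp : Continuous p) (cov : IsCoveringMap p) (e : E) {x : X} (hx : p e = x)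
    {U : Set X} {F : Type*} [TopologicalSpace F] (Φ : p ⁻¹' U ≃ₜ U × F)
    (hΦ : ∀ y, (Φ y).1.1 = p y) (ℓ γ : Path x x) (hℓ : ∀ t, ℓ t ∈ U) :
    (pathClass γ)⁻¹ * pathClass ℓ * pathClass γ ∈ inducedImage hp e hx := by
  have g0 : (γ : C(I, X)) 0 = p e := by rw [hx]; exact γ.source
  set Γ := cov.liftPath (γ : C(I, X)) e g0 with hΓ
  have hl : ∀ t, p (Γ t) = γ t := fun t => congrFun (cov.liftPath_lifts (γ : C(I, X)) e g0) t
  have h0 : Γ 0 = e := cov.liftPath_zero _ _ _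
  have hx1 : p (Γ 1) = x := by rw [hl]; exact γ.target
  have hxU : x ∈ U := by have := hℓ 0; rwa [ℓ.source] at this
  have hΓU : Γ 1 ∈ p ⁻¹' U := by rw [mem_preimage, hx1]; exact hxU
  let f : F := (Φ ⟨Γ 1, hΓU⟩).2
  let s : I → E := fun t => (Φ.symm (⟨ℓ t, hℓ t⟩, f)).1
  have hs : Continuous s := by
    refine continuous_subtype_val.comp (Φ.symm.continuous.comp ?_)
    exact (ℓ.continuous.subtype_mk _).prodMk continuous_const
  have hps : ∀ t, p (s t) = ℓ t := by
    intro t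
    have := hΦ (Φ.symm (⟨ℓ t, hℓ t⟩, f))
    rw [Φ.apply_symm_apply] at this
    exact this.symm
  have hsx : ∀ t, ℓ t = x → s t = Γ 1 := by
    intro t ht
    have : (⟨⟨ℓ t, hℓ t⟩, f⟩ : U × F) = Φ ⟨Γ 1, hΓU⟩ := by
      refine Prod.ext (Subtype.ext ?_) rfl
      rw [hΦ]; simp only; rw [ht, hx1]
    show (Φ.symm (⟨ℓ t, hℓ t⟩, f)).1 = _
    rw [this, Φ.symm_apply_apply]
  let a : Path e (Γ 1) := ⟨Γ, h0, rfl⟩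
  let b : Path (Γ 1) (Γ 1) := ⟨⟨s, hs⟩, hsx 0 ℓ.source, hsx 1 ℓ.target⟩
  refine ⟨(a.trans b).trans a.symm, ?_⟩
  have : ((((a.trans b).trans a.symm).map hp).cast hx.symm hx.symm) =
      (γ.trans ℓ).trans γ.symm := by
    have ha : ∀ t, p (a t) = γ t := hl
    have hb : ∀ t, p (b t) = ℓ t := hps
    ext t
    simp only [Path.cast_coe, Path.map_coe, Function.comp, Path.trans_apply, Path.symm_apply]
    split_ifs <;> simp [ha, hb]
  rw [this, pathClass_trans, pathClass_trans, pathClass_symm, mul_assoc]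

theorem no_cover (K : Subgroup (FundamentalGroup HawaiianEarring hawaiianBasepoint))
    (hK : ∀ N : Subgroup (FundamentalGroup HawaiianEarring hawaiianBasepoint),
        N.Normal → N ≤ K → N = ⊥) : ¬ Nonempty (CoveringRealization K) := by
  rintro ⟨c⟩
  let _ := c.tE
  obtain ⟨-, U, hxU, hU, -, Φ, hΦ⟩ := c.cov hawaiianBasepoint
  obtain ⟨i, hi⟩ := lp_small (hU.mem_nhds hxU)
  have key : Subgroup.normalClosure {pathClass (lp i)} ≤ K := by
    rw [Subgroup.normalClosure, Subgroup.closure_le]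
    intro g hg
    rw [Group.mem_conjugatesOfSet_iff] at hg
    obtain ⟨a, ha, hag⟩ := hg
    rw [mem_singleton_iff] at ha
    subst ha
    rw [isConj_iff] at hag
    obtain ⟨b, rfl⟩ := hag
    obtain ⟨γ, hγ⟩ := pathClass_surj b⁻¹
    have := conj_mem_inducedImage c.cont c.cov c.e c.base Φ hΦ (lp i) γ hi
    rw [hγ, inv_inv, c.img] at this
    exact this
  have h2 := hK _ Subgroup.normalClosure_normal key
  have h3 : pathClass (lp i) ∈ Subgroup.normalClosure {pathClass (lp i)} :=
    Subgroup.subset_normalClosure rfl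
  rw [h2, Subgroup.mem_bot] at h3
  exact lp_ne_one i h3

theorem final :
    ∃ K : Subgroup (FundamentalGroup HawaiianEarring hawaiianBasepoint),
      IsOpen {γ : Path hawaiianBasepoint hawaiianBasepoint | pathClass γ ∈ K} ∧
      (∀ N : Subgroup (FundamentalGroup HawaiianEarring hawaiianBasepoint),
        N.Normal → N ≤ K → N = ⊥) ∧
      ¬ Nonempty (CoveringRealization K) := by
  have hc : ∀ N : Subgroup (FundamentalGroup HawaiianEarring hawaiianBasepoint),
        N.Normal → N ≤ HD.K hawaiianBasepoint → N = ⊥ := by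
    intro N hN hNK
    rw [Subgroup.eq_bot_iff_forall]
    intro a ha
    obtain ⟨α, rfl⟩ := pathClass_surj a
    exact pathClass_eq_one (HD.main HD_base
      (HD.core_H (pathClass (lp 0)) (fun n => H_lp (Nat.zero_le n)) hN hNK ha))
  exact ⟨HD.K hawaiianBasepoint, HD.K_open, hc, no_cover _ hc⟩

end HE

/-- There is a subgroup `K` of `π₁(𝓗, 0)` which is open (the preimage of `K` under
`h : Ω(𝓗,0) → π₁(𝓗,0)` is open in the compact-open topology), core-free (the only
normal subgroup of `π₁(𝓗,0)` contained in `K` is trivial), and which is not the image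
of the fundamental group homomorphism induced by any covering map `p : E → 𝓗` from a
connected, locally path-connected space `E`, based at any `e ∈ E` with `p e = 0`. -/
theorem exists_corefree_open_subgroup_no_covering :
    ∃ K : Subgroup (FundamentalGroup HawaiianEarring hawaiianBasepoint),
      IsOpen {γ : Path hawaiianBasepoint hawaiianBasepoint | pathClass γ ∈ K} ∧
      (∀ N : Subgroup (FundamentalGroup HawaiianEarring hawaiianBasepoint),
        N.Normal → N ≤ K → N = ⊥) ∧
      ¬ Nonempty (CoveringRealization K) := by
  exact HE.final
end

section
/- Let X be a topological space, x ∈ X, and let p : X̂ → X be a local homeomorphism such that every continuous path γ : [0,1] → X admits, for each x̂ ∈ p⁻¹(γ(0)), a unique continuous lift γ̂ : [0,1] → X̂ with γ̂(0) = x̂ and p∘γ̂ = γ, and every continuous homotopy G : [0,1]² → X admits, for each x̂ ∈ p⁻¹(G(0,0)), a unique continuous lift Ĝ with Ĝ(0,0) = x̂ and p∘Ĝ = G. Then for every x̂ ∈ p⁻¹(x), the subgroup p_#(π₁(X̂,x̂)) of π₁(X,x) is open, i.e., h⁻¹(p_#(π₁(X̂,x̂))) is open in Ω(X,x). -/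
open unitInterval

/-- If `p : X̂ → X` is a local homeomorphism with unique lifting of all paths and all
homotopies, then for every `x̂ ∈ p⁻¹(x)` the subgroup `p_#(π₁(X̂,x̂))` of `π₁(X,x)` is
open: its preimage under `h : Ω(X,x) → π₁(X,x)` is open in the compact-open topology
on loops at `x`. -/
theorem inducedImage_isOpen_of_semicovering
    {X E : Type*} [TopologicalSpace X] [TopologicalSpace E]
    {p : E → X} (hp : IsLocalHomeomorph p)
    (hpath : ∀ (γ : C(unitInterval, X)) (e : E), p e = γ 0 →
      ∃! γ' : C(unitInterval, E), γ' 0 = e ∧ p ∘ ⇑γ' = ⇑γ)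
    (hhomotopy : ∀ (G : C(unitInterval × unitInterval, X)) (e : E), p e = G (0, 0) →
      ∃! G' : C(unitInterval × unitInterval, E), G' (0, 0) = e ∧ p ∘ ⇑G' = ⇑G)
    (x : X) (e : E) (he : p e = x) :
    IsOpen {γ : Path x x | pathClass γ ∈ inducedImage hp.continuous e he} := by
  classical
  choose L hL hLu using fun (γ : C(unitInterval, X)) (e : E) (h : p e = γ 0) => hpath γ e h
  -- uniqueness of path lifts
  have huniq : ∀ a b : C(unitInterval, E), a 0 = b 0 → (∀ t, p (a t) = p (b t)) → a = b := by
    intro a b h0 hab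
    obtain ⟨c, -, hc⟩ := hpath ⟨p ∘ b, hp.continuous.comp b.continuous⟩ (b 0) rfl
    rw [hc a ⟨h0, funext hab⟩, hc b ⟨rfl, rfl⟩]
  have hstart : ∀ γ : Path x x, p e = (γ : C(unitInterval, X)) 0 := fun γ => by simp [he]
  let l : Path x x → C(unitInterval, E) := fun γ => L (γ : C(unitInterval, X)) e (hstart γ)
  have l0 : ∀ γ, l γ 0 = e := fun γ => (hL _ e (hstart γ)).1
  have lp : ∀ γ t, p (l γ t) = γ t := fun γ t => congrFun (hL _ e (hstart γ)).2 t
  -- the set consists of the loops whose lift is a loop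
  have hset : {γ : Path x x | pathClass γ ∈ inducedImage hp.continuous e he} =
      {γ | l γ 1 = e} := by
    ext γ
    constructor
    · rintro ⟨δ, hδ⟩
      have hh : Path.Homotopic γ ((δ.map hp.continuous).cast he.symm he.symm) :=
        Quotient.exact hδ
      obtain ⟨G⟩ := hh
      obtain ⟨H, ⟨H0, Hp⟩, -⟩ := hhomotopy G.toContinuousMap e (by
        change p e = G (0, 0)
        simp [he])
      have Hp' : ∀ s t, p (H (s, t)) = G (s, t) := fun s t => congrFun Hp (s, t)
      have hleft := huniq (H.comp ⟨fun s => (s, 0), by fun_prop⟩) (.const _ e) (by simpa using H0)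
        (fun s => by simp [Hp', he])
      have hl' : ∀ s, H (s, 0) = e := fun s => DFunLike.congr_fun hleft s
      have hright := huniq (H.comp ⟨fun s => (s, 1), by fun_prop⟩) (.const _ (H (0, 1)))
        (by simp) (fun s => by simp [Hp'])
      have hr' : ∀ s, H (s, 1) = H (0, 1) := fun s => DFunLike.congr_fun hright s
      have hbot := huniq (H.comp ⟨fun s => (0, s), by fun_prop⟩) (l γ)
        (by simp [l0, H0]) (fun s => by simp [Hp', lp])
      have htop := huniq (H.comp ⟨fun s => (1, s), by fun_prop⟩) δ.toContinuousMap
        (by simp [hl']) (fun s => by simp [Hp'])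
      have h1 : H (0, 1) = l γ 1 := DFunLike.congr_fun hbot 1
      have h2 : H (1, 1) = δ 1 := DFunLike.congr_fun htop 1
      change l γ 1 = e
      rw [← h1, ← hr' 1, h2, δ.target]
    · intro h
      refine ⟨⟨l γ, l0 γ, h⟩, ?_⟩
      congr 1
      ext t
      exact (lp γ t).symm
  rw [hset, isOpen_iff_mem_nhds]
  intro γ hγ
  have hγ' : l γ 1 = e := hγ
  let f : C(unitInterval × Path x x, X) := ⟨fun q => q.2 q.1, by fun_prop⟩
  obtain ⟨N, hN, g, gc, gp, g0, gγ⟩ := hp.exists_lift_nhds (f := f)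
    (g := fun q => l q.2 q.1) (funext fun q => lp q.2 q.1)
    (by simp only [l0]; exact continuous_const) γ (l γ).continuous
  have hg : ∀ a ∈ N, g (1, a) = l a 1 := by
    intro a ha
    have hc : Continuous fun t : unitInterval => g (t, a) :=
      gc.comp_continuous (by fun_prop) fun t => ⟨trivial, ha⟩
    have := huniq ⟨fun t => g (t, a), hc⟩ (l a) (g0 a)
      (fun t => (congrFun gp (t, a)).trans (lp a t).symm)
    exact DFunLike.congr_fun this 1
  obtain ⟨U, hU, heU, hinj⟩ := hp.isLocallyInjective e
  have hcont : ContinuousAt (fun a => g (1, a)) γ :=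
    ContinuousAt.comp (f := fun a : Path x x => ((1 : unitInterval), a))
      (gc.continuousAt (prod_mem_nhds Filter.univ_mem hN))
      (Continuous.continuousAt (by fun_prop))
  have hev := hcont (hU.mem_nhds (by
    change g (1, γ) ∈ U
    rw [gγ]
    change l γ 1 ∈ U
    rwa [hγ']))
  filter_upwards [hN, hev] with a ha ha'
  have ha2 : g (1, a) ∈ U := ha'
  rw [hg a ha] at ha2
  exact hinj ha2 heU (by rw [lp, a.target, he])
end
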